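/- arXiv:1212.0865 — 2 statements merged into one kernel-verified Lean document; each statement's English description precedes it below -/
import Mathlib

section
/- Let L be an even unimodular lattice of dimension 48 with minimum 6. Suppose every automorphism of L of odd prime order has fixed lattice of dimension at most 22, and every automorphism of order 2 other than ±1 has fixed lattice of dimension exactly 24. Then for every σ ∈ Aut(L) of order m, the m-th cyclotomic polynomial Φ_m divides the minimal polynomial of σ. -/
open scoped RealInnerProductSpace

noncomputable section

abbrev Eu (n : ℕ) := EuclideanSpace ℝ (Fin n)

/-- The dual of a set of lattice vectors: all vectors pairing integrally with the set. -/
def dualSet {n : ℕ} (L : Set (Eu n)) : Set (Eu n) :=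
  {x | ∀ y ∈ L, ∃ k : ℤ, ⟪x, y⟫ = (k : ℝ)}

/-- A set of vectors is even if all norms are even integers. -/
def IsEvenLat {n : ℕ} (L : Set (Eu n)) : Prop :=
  ∀ x ∈ L, ∃ k : ℤ, ⟪x, x⟫ = 2 * (k : ℝ)

/-- σ is an automorphism of the lattice L: an orthogonal map preserving L. -/
def IsAutoOf {n : ℕ} (σ : Eu n ≃ₗ[ℝ] Eu n) (L : Submodule ℤ (Eu n)) : Prop :=
  (∀ x y : Eu n, ⟪σ x, σ y⟫ = ⟪x, y⟫) ∧ σ '' (L : Set (Eu n)) = (L : Set (Eu n))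

/-- The fixed space ker(σ - 1). -/
def fixSpace {n : ℕ} (σ : Eu n ≃ₗ[ℝ] Eu n) : Submodule ℝ (Eu n) :=
  LinearMap.ker (σ.toLinearMap - LinearMap.id)

/-- The image space im(σ - 1). -/
def imSpace {n : ℕ} (σ : Eu n ≃ₗ[ℝ] Eu n) : Submodule ℝ (Eu n) :=
  LinearMap.range (σ.toLinearMap - LinearMap.id)

/-- The intersection of a lattice with a rational subspace, as an additive subgroup. -/
def latIn {n : ℕ} (L : Submodule ℤ (Eu n)) (W : Submodule ℝ (Eu n)) : AddSubgroup (Eu n) :=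
  L.toAddSubgroup ⊓ W.toAddSubgroup

/-- The dual lattice of a set S taken inside the subspace W. -/
def dualIn {n : ℕ} (W : Submodule ℝ (Eu n)) (S : Set (Eu n)) : AddSubgroup (Eu n) where
  carrier := {x | x ∈ W ∧ ∀ y ∈ S, ∃ k : ℤ, ⟪x, y⟫ = (k : ℝ)}
  zero_mem' := ⟨W.zero_mem, fun y _ => ⟨0, by simp⟩⟩
  add_mem' := by
    rintro a b ⟨haW, ha⟩ ⟨hbW, hb⟩
    refine ⟨W.add_mem haW hbW, fun y hy => ?_⟩
    obtain ⟨k, hk⟩ := ha y hy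
    obtain ⟨l, hl⟩ := hb y hy
    exact ⟨k + l, by rw [inner_add_left, hk, hl]; push_cast; ring⟩
  neg_mem' := by
    rintro a ⟨haW, ha⟩
    refine ⟨W.neg_mem haW, fun y hy => ?_⟩
    obtain ⟨k, hk⟩ := ha y hy
    exact ⟨-k, by rw [inner_neg_left, hk]; push_cast; ring⟩

/-- An extremal even unimodular lattice of dimension 48: even, unimodular, full rank,
with minimum norm 6. -/
def IsExtremal48 (L : Submodule ℤ (Eu 48)) : Prop :=
  Submodule.span ℝ (L : Set (Eu 48)) = ⊤ ∧
  IsEvenLat (L : Set (Eu 48)) ∧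
  dualSet (L : Set (Eu 48)) = (L : Set (Eu 48)) ∧
  (∀ x ∈ L, x ≠ 0 → 6 ≤ ⟪x, x⟫) ∧
  (∃ x ∈ L, ⟪x, x⟫ = (6 : ℝ))


section Blichfeldt

open MeasureTheory

variable {E : Type*} [NormedAddCommGroup E] [InnerProductSpace ℝ E]

/-- If the points `y i` have pairwise squared distance at least `6`, the truncated densities
`1 - ‖y i‖² / 3` add up to at most one. -/
lemma sum_one_sub_norm_sq_div_le_one {ι : Type*} (s : Finset ι) (y : ι → E)
    (hy : ∀ i ∈ s, ∀ j ∈ s, i ≠ j → 6 ≤ ⟪y i - y j, y i - y j⟫) :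
    ∑ i ∈ s, (1 - ‖y i‖ ^ 2 / 3) ≤ 1 := by
  classical
  rcases s.eq_empty_or_nonempty with rfl | hs
  · simp
  have hk : (1 : ℝ) ≤ s.card := by exact_mod_cast hs.card_pos
  have h1 : ∑ i ∈ s, ∑ j ∈ s, ⟪y i - y j, y i - y j⟫
      = 2 * s.card * ∑ i ∈ s, ‖y i‖ ^ 2 - 2 * ‖∑ i ∈ s, y i‖ ^ 2 := by
    have h3 : ‖∑ i ∈ s, y i‖ ^ 2 = ∑ i ∈ s, ∑ j ∈ s, ⟪y i, y j⟫ := by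
      rw [← real_inner_self_eq_norm_sq, sum_inner]
      exact Finset.sum_congr rfl fun i _ => inner_sum _ _ _
    have h4 : ∀ i j, ⟪y i - y j, y i - y j⟫ = ‖y i‖ ^ 2 + ‖y j‖ ^ 2 - 2 * ⟪y i, y j⟫ := by
      intro i j
      rw [real_inner_sub_sub_self, real_inner_self_eq_norm_sq, real_inner_self_eq_norm_sq]
      ring
    simp_rw [h4, h3, Finset.sum_sub_distrib, Finset.sum_add_distrib, Finset.sum_const,
      ← Finset.mul_sum, nsmul_eq_mul]
    rw [← Finset.mul_sum]
    ring
  have h2 : 6 * (s.card * (s.card - 1) : ℝ) ≤ ∑ i ∈ s, ∑ j ∈ s, ⟪y i - y j, y i - y j⟫ := by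
    have : ∀ i ∈ s, 6 * ((s.card : ℝ) - 1) ≤ ∑ j ∈ s, ⟪y i - y j, y i - y j⟫ := by
      intro i hi
      rw [← Finset.add_sum_erase s _ hi]
      have hle : ∑ j ∈ s.erase i, (6 : ℝ) ≤ ∑ j ∈ s.erase i, ⟪y i - y j, y i - y j⟫ :=
        Finset.sum_le_sum fun j hj => hy i hi j (Finset.mem_of_mem_erase hj)
          (Finset.ne_of_mem_erase hj).symm
      rw [Finset.sum_const, Finset.card_erase_of_mem hi, nsmul_eq_mul,
        Nat.cast_sub hs.card_pos] at hle
      simp only [sub_self, inner_zero_left, zero_add]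
      push_cast at hle
      linarith
    calc 6 * (s.card * (s.card - 1) : ℝ) = ∑ i ∈ s, 6 * ((s.card : ℝ) - 1) := by
          rw [Finset.sum_const, nsmul_eq_mul]; ring
      _ ≤ _ := Finset.sum_le_sum this
  rw [Finset.sum_sub_distrib, Finset.sum_const, nsmul_eq_mul, ← Finset.sum_div]
  have h5 : 0 ≤ ‖∑ i ∈ s, y i‖ ^ 2 := by positivity
  have h6 : 0 ≤ (s.card : ℝ) * (∑ i ∈ s, ‖y i‖ ^ 2 - 3 * (s.card - 1)) := by linarith
  have h7 := nonneg_of_mul_nonneg_right h6 (by linarith)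
  linarith

variable [FiniteDimensional ℝ E] [MeasurableSpace E] [BorelSpace E]

lemma volume_fundamentalDomain_eq_sqrt_det_gram {ι : Type*} [Fintype ι] [DecidableEq ι]
    (b : Module.Basis ι ℝ E) :
    volume (ZSpan.fundamentalDomain b) = ENNReal.ofReal √(Matrix.gram ℝ b).det := by
  let e : OrthonormalBasis ι ℝ E := (stdOrthonormalBasis ℝ E).reindex
    (Fintype.equivOfCardEq (by rw [Fintype.card_fin, Module.finrank_eq_card_basis b]))
  rw [ZSpan.measure_fundamentalDomain b volume e.toBasis,
    measure_congr (ZSpan.fundamentalDomain_ae_parallelepiped e.toBasis volume),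
    OrthonormalBasis.coe_toBasis, e.volume_parallelepiped, mul_one]
  congr 1
  have h : Matrix.gram ℝ b = (e.toBasis.toMatrix b).transpose * e.toBasis.toMatrix b := by
    ext i j
    simp only [Matrix.gram_apply, Matrix.mul_apply, Matrix.transpose_apply,
      Module.Basis.toMatrix_apply, OrthonormalBasis.coe_toBasis_repr_apply,
      OrthonormalBasis.repr_apply_apply]
    rw [← e.sum_inner_mul_inner]
    simp_rw [real_inner_comm (e _) (b i)]
  rw [h, Matrix.det_mul, Matrix.det_transpose, ← sq, Real.sqrt_sq_eq_abs, Module.Basis.det_apply]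

lemma lintegral_one_sub_norm_sq_div [Nontrivial E] {k : ℕ} (hk : Module.finrank ℝ E = 2 * k) :
    ∫⁻ x : E, ENNReal.ofReal (max 0 (1 - ‖x‖ ^ 2 / 3))
      = ENNReal.ofReal ((3 * Real.pi) ^ k / (k + 1).factorial) := by
  rw [lintegral_eq_lintegral_meas_lt (f := fun x : E => max 0 (1 - ‖x‖ ^ 2 / 3)) volume
    (Filter.Eventually.of_forall fun x => le_max_left _ _)
    (by fun_prop)]
  have h1 : ∀ t ∈ Set.Ioi (0 : ℝ), volume {a : E | t < max 0 (1 - ‖a‖ ^ 2 / 3)}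
      = Set.indicator (Set.Ioc 0 1)
        (fun t => ENNReal.ofReal ((3 * (1 - t)) ^ k * (Real.pi ^ k / k.factorial))) t := by
    intro t ht
    have ht : 0 < t := ht
    by_cases h : t ≤ 1
    · have hs : {a : E | t < max 0 (1 - ‖a‖ ^ 2 / 3)} = Metric.ball 0 (√(3 * (1 - t))) := by
        ext a
        simp only [Set.mem_ofPred_eq, Metric.mem_ball, dist_zero_right, lt_max_iff]
        rw [Real.lt_sqrt (norm_nonneg _)]
        constructor
        · rintro (h | h) <;> linarith
        · intro h; right; linarith
      rw [hs, InnerProductSpace.volume_ball_of_dim_even hk, hk, pow_mul,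
        ← ENNReal.ofReal_pow (Real.sqrt_nonneg _), Real.sq_sqrt (by linarith),
        ← ENNReal.ofReal_pow (by linarith), ← ENNReal.ofReal_mul (by
          apply pow_nonneg; linarith)]
      rw [Set.indicator_of_mem (show t ∈ Set.Ioc 0 1 from ⟨ht, h⟩)]
    · have hs : {a : E | t < max 0 (1 - ‖a‖ ^ 2 / 3)} = ∅ := by
        ext a
        simp only [Set.mem_ofPred_eq, lt_max_iff, Set.mem_empty_iff_false, iff_false, not_or,
          not_lt]
        have : 0 ≤ ‖a‖ ^ 2 := by positivity
        constructor <;> linarith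
      rw [hs, Set.indicator_of_notMem (fun h' => h h'.2), measure_empty]
  rw [setLIntegral_congr_fun measurableSet_Ioi h1, lintegral_indicator measurableSet_Ioc,
    Measure.restrict_restrict measurableSet_Ioc,
    Set.inter_eq_left.mpr (fun x hx => hx.1),
    ← ofReal_integral_eq_lintegral_ofReal]
  · congr 1
    rw [← intervalIntegral.integral_of_le zero_le_one, intervalIntegral.integral_mul_const]
    simp_rw [mul_pow]
    rw [intervalIntegral.integral_const_mul,
      intervalIntegral.integral_comp_sub_left (fun x : ℝ => x ^ k) 1]
    simp only [sub_self, sub_zero, integral_pow, one_pow]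
    rw [zero_pow (by omega), Nat.factorial_succ]
    push_cast
    have : (k.factorial : ℝ) ≠ 0 := by positivity
    field_simp
    ring
  · exact (Continuous.integrableOn_Ioc (by fun_prop))
  · refine (ae_restrict_iff' measurableSet_Ioc).mpr (Filter.Eventually.of_forall fun t ht => ?_)
    have : 0 ≤ 1 - t := by linarith [ht.2]
    simp only [Pi.zero_apply]
    positivity

/-- Blichfeldt's bound for a lattice of even rank `2k` and minimum at least `6`. -/
theorem blichfeldt_le_det_gram {ι : Type*} [Fintype ι] [DecidableEq ι] (b : Module.Basis ι ℝ E)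
    {k : ℕ} (hk0 : 0 < k) (hk : Fintype.card ι = 2 * k)
    (hmin : ∀ x ∈ Submodule.span ℤ (Set.range b), x ≠ 0 → 6 ≤ ⟪x, x⟫) :
    ((3 * Real.pi) ^ k / (k + 1).factorial) ^ 2 ≤ (Matrix.gram ℝ b).det := by
  have hfr : Module.finrank ℝ E = 2 * k := by rw [Module.finrank_eq_card_basis b, hk]
  have : Nontrivial E := Module.nontrivial_of_finrank_pos (R := ℝ) (by omega)
  have : VAddInvariantMeasure (Submodule.span ℤ (Set.range b)) E volume :=
    inferInstanceAs <| VAddInvariantMeasure (Submodule.span ℤ (Set.range b)).toAddSubgroup E volume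
  have h1 := (ZSpan.isAddFundamentalDomain b (volume : Measure E)).lintegral_eq_tsum''
    (fun x => ENNReal.ofReal (max 0 (1 - ‖x‖ ^ 2 / 3)))
  rw [lintegral_one_sub_norm_sq_div hfr, ← lintegral_tsum (fun g => by
    simp only [Submodule.vadd_def, vadd_eq_add]
    exact Measurable.aemeasurable (by fun_prop))] at h1
  have h2 : ∀ x : E, ∑' g : Submodule.span ℤ (Set.range b),
      ENNReal.ofReal (max 0 (1 - ‖g +ᵥ x‖ ^ 2 / 3)) ≤ 1 := by
    classical
    intro x
    rw [ENNReal.tsum_eq_iSup_sum]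
    refine iSup_le fun s => ?_
    rw [← ENNReal.ofReal_sum_of_nonneg (fun _ _ => le_max_left _ _), ← ENNReal.ofReal_one]
    apply ENNReal.ofReal_le_ofReal
    have h3 : ∑ g ∈ s, max 0 (1 - ‖g +ᵥ x‖ ^ 2 / 3)
        = ∑ g ∈ s.filter (fun g => ‖g +ᵥ x‖ ^ 2 / 3 ≤ 1), (1 - ‖g +ᵥ x‖ ^ 2 / 3) := by
      rw [Finset.sum_filter]
      refine Finset.sum_congr rfl fun g _ => ?_
      split_ifs with h
      · exact max_eq_right (sub_nonneg.mpr h)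
      · exact max_eq_left (sub_nonpos.mpr (not_le.mp h).le)
    rw [h3]
    refine sum_one_sub_norm_sq_div_le_one _ (fun g : Submodule.span ℤ (Set.range b) => g +ᵥ x) ?_
    intro i _ j _ hij
    have : (i +ᵥ x) - (j +ᵥ x) = ((i - j : Submodule.span ℤ (Set.range b)) : E) := by
      simp [Submodule.vadd_def]
    rw [this]
    refine hmin _ (i - j).2 ?_
    simpa [sub_eq_zero] using hij
  have h3 : ENNReal.ofReal ((3 * Real.pi) ^ k / (k + 1).factorial)
      ≤ ENNReal.ofReal √(Matrix.gram ℝ b).det := by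
    rw [h1, ← volume_fundamentalDomain_eq_sqrt_det_gram]
    calc _ ≤ ∫⁻ _ in ZSpan.fundamentalDomain b, 1 := lintegral_mono h2
      _ = _ := by simp
  have hpos : 0 < (3 * Real.pi) ^ k / (k + 1).factorial := by positivity
  have h4 : (3 * Real.pi) ^ k / (k + 1).factorial ≤ √(Matrix.gram ℝ b).det := by
    by_contra hlt
    rw [not_le] at hlt
    exact absurd h3 (not_le.mpr ((ENNReal.ofReal_lt_ofReal_iff hpos).mpr hlt))
  have h5 : 0 < (Matrix.gram ℝ b).det := Real.sqrt_pos.mp (hpos.trans_le h4)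
  exact (Real.le_sqrt hpos.le h5.le).mp h4

end Blichfeldt

section AdaptedBasis

open Module Submodule

lemma exists_int_toMatrix {W : Type*} [AddCommGroup W] [Module ℝ W] {ι : Type*} [Fintype ι]
    [DecidableEq ι] (β : Basis ι ℝ W) (s : Module.End ℝ W)
    (hs : ∀ x ∈ span ℤ (Set.range β), s x ∈ span ℤ (Set.range β)) :
    ∃ M : Matrix ι ι ℤ, LinearMap.toMatrix β β s = M.map (Int.cast : ℤ → ℝ) := by
  have h : ∀ i j, ∃ a : ℤ, (a : ℝ) = β.repr (s (β j)) i := fun i j =>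
    (β.mem_span_iff_repr_mem ℤ _).mp (hs _ (subset_span ⟨j, rfl⟩)) i
  choose M hM using h
  exact ⟨Matrix.of M, by ext i j; simp [LinearMap.toMatrix_apply, hM]⟩

lemma toMatrix_aeval_eq_map_aeval {W : Type*} [AddCommGroup W] [Module ℝ W] {ι : Type*}
    [Fintype ι] [DecidableEq ι] (β : Basis ι ℝ W) (s : Module.End ℝ W) (M : Matrix ι ι ℤ)
    (hM : LinearMap.toMatrix β β s = M.map (Int.cast : ℤ → ℝ)) (h : Polynomial ℤ) :
    LinearMap.toMatrix β β (Polynomial.aeval s h)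
      = (Polynomial.aeval M h).map (Int.cast : ℤ → ℝ) := by
  have h1 := Polynomial.aeval_algHom_apply
    (LinearMap.toMatrixAlgEquiv β : Module.End ℝ W →+* Matrix ι ι ℝ).toIntAlgHom s h
  have h2 := Polynomial.aeval_algHom_apply
    (Int.castRingHom ℝ).mapMatrix.toIntAlgHom M h
  have h3 : LinearMap.toMatrixAlgEquiv β s = M.map (Int.cast : ℤ → ℝ) := hM
  change LinearMap.toMatrixAlgEquiv β (Polynomial.aeval s h) = _
  simp only [RingHom.toIntAlgHom_apply, RingHom.coe_coe, RingHom.mapMatrix_apply,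
    Int.coe_castRingHom] at h1 h2
  rw [← h1, ← h2, h3]

variable {E : Type*} [NormedAddCommGroup E] [NormedSpace ℝ E] [FiniteDimensional ℝ E]

/-- A lattice has an integral basis whose first part is an integral basis of its intersection
with a given rational subspace. -/
lemma exists_basis_adapted (L : Submodule ℤ E) [DiscreteTopology L] [IsZLattice ℝ L]
    (U : Submodule ℝ E) (hU : U ≤ span ℝ {x | x ∈ L ∧ x ∈ U}) :
    ∃ (n k : ℕ) (B : Basis (Fin n ⊕ Fin k) ℝ E) (β : Basis (Fin n) ℝ U),
      span ℤ (Set.range B) = L ∧ (∀ i, (β i : E) = B (Sum.inl i)) ∧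
      ∀ x : U, (x : E) ∈ L ↔ x ∈ span ℤ (Set.range β) := by
  have : Module.Finite ℤ L := ZLattice.module_finite ℝ L
  have : Module.Free ℤ L := ZLattice.module_free ℝ L
  let N : Submodule ℤ L := (U.restrictScalars ℤ).comap L.subtype
  have hN : Module.IsTorsionFree ℤ (L ⧸ N) := by
    refine .of_smul_eq_zero fun r y hy => ?_
    obtain ⟨x, rfl⟩ := N.mkQ_surjective y
    rw [← map_smul, mkQ_apply, Quotient.mk_eq_zero] at hy
    refine or_iff_not_imp_left.mpr fun hr => ?_
    rw [mkQ_apply, Quotient.mk_eq_zero]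
    have h1 : r • (x : E) ∈ U := hy
    rw [← Int.cast_smul_eq_zsmul ℝ] at h1
    exact (U.smul_mem_iff (Int.cast_ne_zero.mpr hr)).mp h1
  have : Module.Free ℤ (L ⧸ N) := inferInstance
  let bN := Module.finBasis ℤ N
  let bQ := Module.finBasis ℤ (L ⧸ N)
  let b := Basis.sumQuot bN bQ
  have hb : ∀ i, b.ofZLatticeBasis ℝ L (Sum.inl i) = (bN i : E) := fun i => by
    rw [Basis.ofZLatticeBasis_apply]
    simp only [b, Basis.sumQuot_inl]
  have hmem : ∀ x ∈ L, x ∈ U →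
      x ∈ span ℤ (Set.range fun i => b.ofZLatticeBasis ℝ L (Sum.inl i)) := by
    intro x hx hxU
    have h1 : (⟨⟨x, hx⟩, hxU⟩ : N) ∈ span ℤ (Set.range bN) := by simp [bN.span_eq]
    have h2 := Submodule.mem_map_of_mem (f := L.subtype ∘ₗ N.subtype) h1
    rw [Submodule.map_span, ← Set.range_comp] at h2
    simp_rw [hb]
    exact h2
  have hbU : ∀ i, b.ofZLatticeBasis ℝ L (Sum.inl i) ∈ U := fun i => by
    rw [hb]
    exact (bN i).2
  have hli : LinearIndependent ℝ
      (fun i => (⟨b.ofZLatticeBasis ℝ L (Sum.inl i), hbU i⟩ : U)) :=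
    .of_comp U.subtype ((b.ofZLatticeBasis ℝ L).linearIndependent.comp _ Sum.inl_injective)
  have hsp : ⊤ ≤ span ℝ
      (Set.range fun i => (⟨b.ofZLatticeBasis ℝ L (Sum.inl i), hbU i⟩ : U)) := by
    rw [← Submodule.map_le_map_iff_of_injective U.injective_subtype, Submodule.map_span,
      ← Set.range_comp, Submodule.map_top, range_subtype]
    refine hU.trans (span_le.mpr fun x hx => ?_)
    exact span_le_restrictScalars ℤ ℝ _ (hmem x hx.1 hx.2)
  refine ⟨_, _, b.ofZLatticeBasis ℝ L, Basis.mk hli hsp, b.ofZLatticeBasis_span ℝ L,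
    fun i => by rw [Basis.mk_apply], fun x => ?_⟩
  have hmap : (span ℤ (Set.range (Basis.mk hli hsp))).map (U.subtype.restrictScalars ℤ)
      = span ℤ (Set.range fun i => b.ofZLatticeBasis ℝ L (Sum.inl i)) := by
    rw [Submodule.map_span, ← Set.range_comp]
    congr 2
    ext i
    simp
  constructor
  · intro hx
    have h1 := hmem x hx x.2
    rw [← hmap] at h1
    obtain ⟨y, hy, hyx⟩ := h1
    exact Subtype.ext hyx ▸ hy
  · intro hx
    have h1 := Submodule.mem_map_of_mem (f := U.subtype.restrictScalars ℤ) hx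
    rw [hmap] at h1
    refine (span_le.mpr ?_ : _ ≤ L) h1
    rintro _ ⟨i, rfl⟩
    simp only [SetLike.mem_coe, hb]
    exact (bN i).1.2

end AdaptedBasis

section Unimodular

open Module Submodule

/-- Jacobi's identity for complementary minors, for a matrix with right inverse. -/
lemma det_mul_det_toBlocks_eq {ι κ R : Type*} [Fintype ι] [Fintype κ] [DecidableEq ι]
    [DecidableEq κ] [CommRing R] (P Q : Matrix (ι ⊕ κ) (ι ⊕ κ) R) (h : P * Q = 1) :
    P.det * Q.toBlocks₂₂.det = P.toBlocks₁₁.det := by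
  have h1 : P * Matrix.fromBlocks 1 Q.toBlocks₁₂ 0 Q.toBlocks₂₂
      = Matrix.fromBlocks P.toBlocks₁₁ 0 P.toBlocks₂₁ 1 := by
    have h2 := h
    rw [← P.fromBlocks_toBlocks, ← Q.fromBlocks_toBlocks, Matrix.fromBlocks_multiply,
      ← Matrix.fromBlocks_one, Matrix.fromBlocks_inj] at h2
    conv_lhs => rw [← P.fromBlocks_toBlocks]
    rw [Matrix.fromBlocks_multiply, h2.2.1, h2.2.2.2]
    simp
  have h3 := congrArg Matrix.det h1
  rw [Matrix.det_mul, Matrix.det_fromBlocks_zero₂₁, Matrix.det_fromBlocks_zero₁₂] at h3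
  simpa using h3

variable {E : Type*} [NormedAddCommGroup E] [InnerProductSpace ℝ E]

/-- If `f` maps a lattice into `U` and `f (β i)` is expressed through the Gram matrix, then the
determinant of the Gram matrix divides the determinant of `f` on `U`. -/
lemma exists_det_eq_det_gram_mul {U : Submodule ℝ E} {ι : Type*} [Fintype ι] [DecidableEq ι]
    (β : Basis ι ℝ U) (L : Submodule ℤ E)
    (hβ : ∀ x : U, (x : E) ∈ L → x ∈ span ℤ (Set.range β))
    (γ : ι → E) (hγ : ∀ i, γ i ∈ L) (V : Submodule ℝ E)
    (hβγ : ∀ i, (β i : E) - ∑ j, ⟪(β i : E), (β j : E)⟫ • γ j ∈ V)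
    (f : Module.End ℝ E) (hfL : ∀ x ∈ L, f x ∈ L) (hfV : ∀ x ∈ V, f x = 0)
    (hfU : ∀ x, f x ∈ U) (u : Module.End ℝ U) (hu : ∀ x, (u x : E) = f x) :
    ∃ a : ℤ, LinearMap.det u = (Matrix.gram ℝ β).det * a := by
  have h : ∀ i j, ∃ a : ℤ, (a : ℝ) = β.repr ⟨f (γ j), hfU _⟩ i := fun i j =>
    (β.mem_span_iff_repr_mem ℤ _).mp (hβ _ (hfL _ (hγ j))) i
  choose A hA using h
  refine ⟨(Matrix.of A).det, ?_⟩
  have h1 : LinearMap.toMatrix β β u = (Matrix.of A).map (Int.cast : ℤ → ℝ) * Matrix.gram ℝ β := by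
    ext i j
    have h2 : u (β j) = ∑ l, ⟪(β j : E), (β l : E)⟫ • (⟨f (γ l), hfU _⟩ : U) := by
      apply Subtype.ext
      have h3 := hfV _ (hβγ j)
      rw [map_sub, sub_eq_zero] at h3
      rw [hu, h3]
      simp
    rw [LinearMap.toMatrix_apply, h2, Matrix.mul_apply]
    simp only [map_sum, map_smul, Finsupp.coe_finsetSum, Finset.sum_apply, Finsupp.smul_apply,
      smul_eq_mul, Matrix.map_apply, Matrix.of_apply, hA, Matrix.gram_apply]
    refine Finset.sum_congr rfl fun l _ => ?_
    rw [mul_comm, real_inner_comm]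
    rfl
  rw [← LinearMap.det_toMatrix β, h1, Matrix.det_mul, mul_comm]
  congr 1
  exact ((Int.castRingHom ℝ).map_det _).symm

lemma exists_dual_basis {ι : Type*} [Fintype ι] [DecidableEq ι] (B : Basis ι ℝ E) :
    ∃ C : Basis ι ℝ E, (∀ x i, B.repr x i = ⟪x, C i⟫) ∧ ∀ x i, C.repr x i = ⟪x, B i⟫ := by
  have hnd : (innerₗ E : LinearMap.BilinForm ℝ E).Nondegenerate := by
    refine ⟨fun x hx => ?_, fun x hx => ?_⟩ <;>
      exact inner_self_eq_zero.mp (hx x)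
  have hsymm : LinearMap.BilinForm.IsSymm (innerₗ E) := ⟨fun x y => real_inner_comm _ _⟩
  refine ⟨LinearMap.BilinForm.dualBasis _ hnd B, fun x i => ?_, fun x i => ?_⟩
  · conv_lhs => rw [← LinearMap.BilinForm.dualBasis_dualBasis hnd hsymm B]
    rw [LinearMap.BilinForm.dualBasis_repr_apply]
    rfl
  · rw [LinearMap.BilinForm.dualBasis_repr_apply]
    rfl

variable [FiniteDimensional ℝ E]

/-- Let `U` be a rational subspace of a unimodular lattice `L`, with orthogonal complement `V`.
The Gram determinants of `L ∩ U` and `L ∩ V` agree up to sign, and divide the determinants on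
`U` and on `V` of all endomorphisms of `L` that map into that subspace and kill the other. -/
theorem exists_basis_gram_det_dvd (L : Submodule ℤ E) [DiscreteTopology L] [IsZLattice ℝ L]
    (hL : ∀ x, x ∈ L ↔ ∀ y ∈ L, ∃ k : ℤ, ⟪x, y⟫ = (k : ℝ))
    (U V : Submodule ℝ E) (hUV : Uᗮ = V) (hU : U ≤ span ℝ {x | x ∈ L ∧ x ∈ U}) :
    ∃ (n : ℕ) (β : Basis (Fin n) ℝ U) (D : ℤ),
      (∀ x : U, (x : E) ∈ L ↔ x ∈ span ℤ (Set.range β)) ∧ (Matrix.gram ℝ β).det = D ∧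
      (∀ (f : Module.End ℝ E) (u : Module.End ℝ U), (∀ x ∈ L, f x ∈ L) → (∀ x ∈ V, f x = 0) →
        (∀ x, f x ∈ U) → (∀ x, (u x : E) = f x) → ∃ a : ℤ, LinearMap.det u = D * a) ∧
      (∀ (f : Module.End ℝ E) (u : Module.End ℝ V), (∀ x ∈ L, f x ∈ L) → (∀ x ∈ U, f x = 0) →
        (∀ x, f x ∈ V) → (∀ x, (u x : E) = f x) → ∃ a : ℤ, LinearMap.det u = D * a) := by
  obtain ⟨n, k, B, β, hB, hβB, hβ⟩ := exists_basis_adapted L U hU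
  obtain ⟨C, hC, hC'⟩ := exists_dual_basis B
  have hBL : ∀ i, B i ∈ L := fun i => hB ▸ subset_span ⟨i, rfl⟩
  have hBC : ∀ i j, ⟪B i, C j⟫ = if i = j then 1 else 0 := fun i j => by
    rw [← hC, B.repr_self, Finsupp.single_apply]
  have hCL : ∀ i, C i ∈ L := fun i => by
    rw [hL]
    intro y hy
    rw [← hB] at hy
    obtain ⟨a, ha⟩ := (B.mem_span_iff_repr_mem ℤ _).mp hy i
    exact ⟨a, by rw [real_inner_comm, ← hC, ← ha]; rfl⟩
  have hsumC : ∀ x, x = ∑ j, ⟪x, B j⟫ • C j := fun x => by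
    conv_lhs => rw [← C.sum_repr x]
    simp_rw [hC']
  have hsumB : ∀ x, x = ∑ j, ⟪x, C j⟫ • B j := fun x => by
    conv_lhs => rw [← B.sum_repr x]
    simp_rw [hC]
  have hgram : ∀ v : Fin n ⊕ Fin k → E, (∀ i, v i ∈ L) →
      ∃ M : Matrix (Fin n ⊕ Fin k) (Fin n ⊕ Fin k) ℤ,
        Matrix.gram ℝ v = (Int.castRingHom ℝ).mapMatrix M := by
    intro v hv
    choose M hM using fun i j => (hL (v i)).mp (hv i) (v j) (hv j)
    exact ⟨Matrix.of M, by ext i j; simp [Matrix.gram_apply, hM]⟩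
  obtain ⟨P, hP⟩ := hgram B hBL
  obtain ⟨Q, hQ⟩ := hgram C hCL
  have hPQ : P * Q = 1 := by
    apply Matrix.map_injective (f := Int.castRingHom ℝ) Int.cast_injective
    change (Int.castRingHom ℝ).mapMatrix (P * Q) = (Int.castRingHom ℝ).mapMatrix 1
    rw [map_mul, map_one, ← hP, ← hQ]
    ext i l
    have h1 := congrArg (fun x => ⟪x, C l⟫) (hsumC (B i))
    simp only [sum_inner, real_inner_smul_left, hBC] at h1
    rw [Matrix.mul_apply, Matrix.one_apply, h1]
    rfl
  have hVmem : ∀ x, x ∈ V ↔ ∀ i, ⟪x, B (Sum.inl i)⟫ = 0 := by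
    intro x
    rw [← hUV, Submodule.mem_orthogonal']
    constructor
    · intro h i
      rw [← hβB]
      exact h _ (β i).2
    · intro h y hy
      have h1 : y = ∑ i, β.repr ⟨y, hy⟩ i • B (Sum.inl i) := by
        have h2 := congrArg U.subtype (β.sum_repr ⟨y, hy⟩)
        simp only [map_sum, map_smul, Submodule.subtype_apply, hβB] at h2
        exact h2.symm
      rw [h1, inner_sum]
      simp [inner_smul_right, h]
  have hCV : ∀ i, C (Sum.inr i) ∈ V := fun i => (hVmem _).mpr fun j => by
    rw [real_inner_comm, hBC]; simp
  have hVsum : ∀ x ∈ V, x = ∑ j, ⟪x, B (Sum.inr j)⟫ • C (Sum.inr j) := by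
    intro x hx
    conv_lhs => rw [hsumC x]
    rw [Fintype.sum_sum_type]
    simp [(hVmem x).mp hx]
  let β' : Basis (Fin k) ℝ V := Basis.mk (v := fun i => (⟨C (Sum.inr i), hCV i⟩ : V))
    (.of_comp V.subtype (C.linearIndependent.comp _ Sum.inr_injective)) (by
      rintro ⟨x, hx⟩ -
      have h1 : (⟨x, hx⟩ : V) = ∑ j, ⟪x, B (Sum.inr j)⟫ • (⟨C (Sum.inr j), hCV j⟩ : V) := by
        apply Subtype.ext
        simpa using hVsum x hx
      rw [h1]
      exact sum_mem fun j _ => smul_mem _ _ (subset_span ⟨j, rfl⟩))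
  have hβ'C : ∀ i, (β' i : E) = C (Sum.inr i) := fun i => by simp [β']
  have hβ' : ∀ x : V, (x : E) ∈ L → x ∈ span ℤ (Set.range β') := by
    rintro ⟨x, hx⟩ hxL
    choose a ha using fun j => (hL x).mp hxL (B (Sum.inr j)) (hBL _)
    have h1 : (⟨x, hx⟩ : V) = ∑ j, a j • β' j := by
      apply Subtype.ext
      have h2 := hVsum x hx
      simp_rw [ha, Int.cast_smul_eq_zsmul] at h2
      simpa [hβ'C] using h2
    rw [h1]
    exact sum_mem fun j _ => smul_mem _ _ (subset_span ⟨j, rfl⟩)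
  have hβsub : ∀ i, (β i : E) - ∑ j, ⟪(β i : E), (β j : E)⟫ • C (Sum.inl j) ∈ V := by
    intro i
    have h1 := hsumC (β i)
    rw [Fintype.sum_sum_type] at h1
    simp_rw [hβB] at h1 ⊢
    rw [sub_eq_of_eq_add' h1]
    exact sum_mem fun j _ => smul_mem _ _ (hCV j)
  have hβ'sub : ∀ i, (β' i : E) - ∑ j, ⟪(β' i : E), (β' j : E)⟫ • B (Sum.inr j) ∈ U := by
    intro i
    have h1 := hsumB (β' i)
    rw [Fintype.sum_sum_type] at h1
    simp_rw [hβ'C] at h1 ⊢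
    rw [sub_eq_of_eq_add h1]
    exact sum_mem fun j _ => smul_mem _ _ (hβB j ▸ (β j).2)
  have hG : (Matrix.gram ℝ β).det = (P.toBlocks₁₁.det : ℤ) := by
    refine Eq.trans ?_ ((Int.castRingHom ℝ).map_det _).symm
    congr 1
    ext i j
    have h1 := congrFun (congrFun hP (Sum.inl i)) (Sum.inl j)
    rw [Matrix.gram_apply, ← hβB, ← hβB] at h1
    exact h1
  have hZ : (Matrix.gram ℝ β').det = (Q.toBlocks₂₂.det : ℤ) := by
    refine Eq.trans ?_ ((Int.castRingHom ℝ).map_det _).symm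
    congr 1
    ext i j
    have h1 := congrFun (congrFun hQ (Sum.inr i)) (Sum.inr j)
    rw [Matrix.gram_apply, ← hβ'C, ← hβ'C] at h1
    exact h1
  have hdet := det_mul_det_toBlocks_eq P Q hPQ
  have hunit : IsUnit P.det :=
    IsUnit.of_mul_eq_one Q.det (by rw [← Matrix.det_mul, hPQ, Matrix.det_one])
  refine ⟨n, β, P.toBlocks₁₁.det, hβ, hG, fun f u hfL hfV hfU hu => ?_,
    fun f u hfL hfU hfV hu => ?_⟩
  · rw [← hG]
    exact exists_det_eq_det_gram_mul β L (fun x => (hβ x).mp) _ (fun i => hCL (Sum.inl i)) V hβsub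
      f hfL hfV hfU u hu
  · obtain ⟨a, ha⟩ := exists_det_eq_det_gram_mul β' L hβ' _ (fun i => hBL (Sum.inr i)) U hβ'sub
      f hfL hfU hfV u hu
    obtain ⟨b, hb⟩ := hunit.exists_right_inv
    refine ⟨b * a, ?_⟩
    rw [ha, hZ, ← hdet, ← Int.cast_mul, ← Int.cast_mul]
    congr 1
    linear_combination (-Q.toBlocks₂₂.det * a) * hb

end Unimodular

section CyclotomicKernel

open Module Polynomial

/-- The product of the cyclotomic polynomials with index in a finite set. -/
def cyclProd (S : Finset ℕ) : ℤ[X] := ∏ d ∈ S, cyclotomic d ℤ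

lemma cyclProd_union {S T : Finset ℕ} (h : Disjoint S T) :
    cyclProd (S ∪ T) = cyclProd S * cyclProd T := Finset.prod_union h

lemma cyclProd_singleton (d : ℕ) : cyclProd {d} = cyclotomic d ℤ := Finset.prod_singleton _ _

lemma cyclProd_divisors {m : ℕ} (hm : 0 < m) : cyclProd m.divisors = X ^ m - 1 :=
  prod_cyclotomic_eq_X_pow_sub_one hm ℤ

variable {E : Type*} [AddCommGroup E] [Module ℝ E]

lemma aeval_map_intCast (s : End ℝ E) (p : ℤ[X]) :
    aeval s (p.map (algebraMap ℤ ℝ)) = aeval s p :=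
  aeval_map_algebraMap ℝ s p

lemma aeval_aeval_comm (s : End ℝ E) (p q : ℤ[X]) (x : E) :
    aeval s p (aeval s q x) = aeval s q (aeval s p x) := by
  rw [← Module.End.mul_apply, ← Module.End.mul_apply, ← map_mul, ← map_mul, mul_comm]

lemma aeval_aeval_comm_real (s : End ℝ E) (p : ℝ[X]) (q : ℤ[X]) (x : E) :
    aeval s p (aeval s q x) = aeval s q (aeval s p x) := by
  rw [← aeval_map_intCast, ← Module.End.mul_apply, ← Module.End.mul_apply, ← map_mul, ← map_mul,
    mul_comm]

lemma exists_aeval_cyclProd_bezout {S T : Finset ℕ} (h : Disjoint S T) (s : End ℝ E) :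
    ∃ a b : ℝ[X], ∀ x, aeval s a (aeval s (cyclProd S) x) + aeval s b (aeval s (cyclProd T) x)
      = x := by
  have h1 : IsCoprime ((cyclProd S).map (algebraMap ℤ ℝ)) ((cyclProd T).map (algebraMap ℤ ℝ)) := by
    simp only [cyclProd, Polynomial.map_prod, map_cyclotomic]
    refine IsCoprime.prod_left fun i hi => IsCoprime.prod_right fun j hj => ?_
    have h2 := (cyclotomic.isCoprime_rat (Finset.disjoint_iff_ne.mp h i hi j hj)).map
      (mapRingHom (algebraMap ℚ ℝ))
    simpa using h2
  obtain ⟨a, b, hab⟩ := h1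
  refine ⟨a, b, fun x => ?_⟩
  have h2 := congrArg (fun p => aeval s p x) hab
  simp only [map_add, map_mul, map_one, aeval_map_intCast] at h2
  exact h2

/-- The kernel of a product of cyclotomic polynomials in an endomorphism. -/
def cyclKer (s : End ℝ E) (S : Finset ℕ) : Submodule ℝ E := LinearMap.ker (aeval s (cyclProd S))

lemma mem_cyclKer {s : End ℝ E} {S : Finset ℕ} {x : E} :
    x ∈ cyclKer s S ↔ aeval s (cyclProd S) x = 0 := Iff.rfl

lemma cyclKer_empty (s : End ℝ E) : cyclKer s ∅ = ⊥ := by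
  ext x
  simp [mem_cyclKer, cyclProd]

lemma apply_mem_cyclKer {s : End ℝ E} {S : Finset ℕ} {x : E} (hx : x ∈ cyclKer s S) :
    s x ∈ cyclKer s S := by
  rw [mem_cyclKer] at *
  have h := aeval_aeval_comm s X (cyclProd S) x
  simp only [aeval_X] at h
  rw [← h, hx, map_zero]

/-- The restriction of an endomorphism to a kernel of a product of cyclotomic polynomials. -/
def cyclRes (s : End ℝ E) (S : Finset ℕ) : End ℝ (cyclKer s S) :=
  s.restrict fun _ => apply_mem_cyclKer

lemma coe_aeval_cyclRes (s : End ℝ E) (S : Finset ℕ) (h : ℤ[X]) (x : cyclKer s S) :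
    (aeval (cyclRes s S) h x : E) = aeval s h x := by
  induction h using Polynomial.induction_on generalizing x with
  | C a => simp
  | add p q hp hq => simp [hp, hq]
  | monomial n a ih =>
    rw [pow_succ, ← mul_assoc, map_mul _ _ X, map_mul _ _ X, aeval_X, aeval_X,
      Module.End.mul_apply, Module.End.mul_apply, ih]
    rfl

lemma aeval_cyclRes_cyclProd (s : End ℝ E) (S : Finset ℕ) :
    aeval (cyclRes s S) (cyclProd S) = 0 := by
  ext x
  rw [coe_aeval_cyclRes]
  exact x.2

lemma cyclKer_mono {s : End ℝ E} {S T : Finset ℕ} (h : S ⊆ T) : cyclKer s S ≤ cyclKer s T := by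
  intro x hx
  have h1 : cyclProd T = cyclProd (T \ S) * cyclProd S := by
    rw [← cyclProd_union Finset.sdiff_disjoint, Finset.sdiff_union_of_subset h]
  rw [mem_cyclKer, h1, map_mul, Module.End.mul_apply, mem_cyclKer.mp hx, map_zero]

/-- Kernels of coprime products of cyclotomic polynomials form a direct sum. -/
def cyclKerProdEquiv (s : End ℝ E) {S T : Finset ℕ} (h : Disjoint S T) :
    (cyclKer s S × cyclKer s T) ≃ₗ[ℝ] cyclKer s (S ∪ T) :=
  LinearEquiv.ofBijective
    ((Submodule.inclusion (cyclKer_mono Finset.subset_union_left)).coprod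
      (Submodule.inclusion (cyclKer_mono Finset.subset_union_right))) (by
    obtain ⟨a, b, hab⟩ := exists_aeval_cyclProd_bezout h s
    constructor
    · rw [← LinearMap.ker_eq_bot, LinearMap.ker_eq_bot']
      rintro ⟨⟨x, hx⟩, ⟨y, hy⟩⟩ hxy
      have hxy' : x + y = 0 := congrArg Subtype.val hxy
      have hx' : x = 0 := by
        rw [← hab x, mem_cyclKer.mp hx, eq_neg_of_add_eq_zero_left hxy', map_neg,
          mem_cyclKer.mp hy]
        simp
      have hy' : y = 0 := by rwa [hx', zero_add] at hxy'
      simp [hx', hy']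
    · rintro ⟨z, hz⟩
      have hz' : aeval s (cyclProd S) (aeval s (cyclProd T) z) = 0 := by
        rw [← Module.End.mul_apply, ← map_mul, ← cyclProd_union h]
        exact hz
      refine ⟨⟨⟨aeval s b (aeval s (cyclProd T) z), ?_⟩,
        ⟨aeval s a (aeval s (cyclProd S) z), ?_⟩⟩, ?_⟩
      · rw [mem_cyclKer, ← aeval_aeval_comm_real, hz', map_zero]
      · rw [mem_cyclKer, ← aeval_aeval_comm_real, aeval_aeval_comm s (cyclProd T), hz', map_zero]
      · apply Subtype.ext
        exact (add_comm _ _).trans (hab z))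

lemma coe_cyclKerProdEquiv (s : End ℝ E) {S T : Finset ℕ} (h : Disjoint S T)
    (x : cyclKer s S × cyclKer s T) : (cyclKerProdEquiv s h x : E) = x.1 + x.2 := rfl

variable [FiniteDimensional ℝ E]

lemma finrank_cyclKer_union (s : End ℝ E) {S T : Finset ℕ} (h : Disjoint S T) :
    finrank ℝ (cyclKer s (S ∪ T)) = finrank ℝ (cyclKer s S) + finrank ℝ (cyclKer s T) := by
  rw [← (cyclKerProdEquiv s h).finrank_eq, finrank_prod]

lemma det_aeval_cyclRes_union (s : End ℝ E) {S T : Finset ℕ} (h : Disjoint S T) (p : ℤ[X]) :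
    LinearMap.det (aeval (cyclRes s (S ∪ T)) p)
      = LinearMap.det (aeval (cyclRes s S) p) * LinearMap.det (aeval (cyclRes s T) p) := by
  rw [← LinearMap.det_prodMap, ← LinearMap.det_conj _ (cyclKerProdEquiv s h)]
  congr 1
  ext x
  obtain ⟨y, rfl⟩ := (cyclKerProdEquiv s h).surjective x
  simp only [LinearMap.comp_apply, LinearEquiv.coe_coe, LinearEquiv.symm_apply_apply]
  rw [coe_aeval_cyclRes, coe_cyclKerProdEquiv, coe_cyclKerProdEquiv, map_add]
  simp [coe_aeval_cyclRes]

lemma finrank_cyclKer (s : End ℝ E) (S : Finset ℕ) :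
    finrank ℝ (cyclKer s S) = ∑ d ∈ S, finrank ℝ (cyclKer s {d}) := by
  induction S using Finset.induction_on with
  | empty => rw [cyclKer_empty, finrank_bot, Finset.sum_empty]
  | insert d S hd ih =>
    rw [Finset.sum_insert hd, Finset.insert_eq, finrank_cyclKer_union s (by simpa using hd), ih]

lemma det_aeval_cyclRes (s : End ℝ E) (S : Finset ℕ) (p : ℤ[X]) :
    LinearMap.det (aeval (cyclRes s S) p) = ∏ d ∈ S, LinearMap.det (aeval (cyclRes s {d}) p) := by
  induction S using Finset.induction_on with
  | empty =>
    have : Subsingleton (cyclKer s ∅) := (Submodule.subsingleton_iff_eq_bot).mpr (cyclKer_empty s)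
    simp [LinearMap.det_eq_one_of_subsingleton]
  | insert d S hd ih =>
    rw [Finset.prod_insert hd, Finset.insert_eq, det_aeval_cyclRes_union s (by simpa using hd), ih]

end CyclotomicKernel

section CyclotomicMatrix

open Polynomial

variable {ι : Type*} [Fintype ι] [DecidableEq ι]

lemma Commute.sub_dvd_aeval_sub_aeval {A R : Type*} [CommRing A] [Ring R] [Algebra A R]
    {a b : R} (h : Commute a b) (p : A[X]) :
    a - b ∣ aeval a p - aeval b p := by
  rw [aeval_eq_sum_range, aeval_eq_sum_range, ← Finset.sum_sub_distrib]
  refine Finset.dvd_sum fun i _ => ?_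
  obtain ⟨c, hc⟩ := h.sub_dvd_pow_sub_pow i
  exact ⟨p.coeff i • c, by rw [← smul_sub, hc, mul_smul_comm]⟩

lemma charpoly_dvd_pow_of_aeval_eq_zero {A : Type*} [CommRing A] (M : Matrix ι ι A) (p : A[X])
    (h : aeval M p = 0) : M.charpoly ∣ p ^ Fintype.card ι := by
  have h1 : aeval (Matrix.scalar ι (X : A[X])) p = Matrix.scalar ι p := by
    have := aeval_algebraMap_apply (Matrix ι ι A[X]) (X : A[X]) p
    rwa [aeval_X_left_apply] at this
  have h2 : aeval ((C : A →+* A[X]).mapMatrix M) p = 0 := by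
    have := aeval_algHom_apply (CAlgHom : A →ₐ[A] A[X]).mapMatrix M p
    rwa [h, map_zero] at this
  obtain ⟨Q, hQ⟩ := (Matrix.scalar_commute (X : A[X]) (fun r => Commute.all _ r)
    ((C : A →+* A[X]).mapMatrix M)).sub_dvd_aeval_sub_aeval p
  rw [h1, h2, sub_zero] at hQ
  refine ⟨Q.det, ?_⟩
  have h3 := congrArg Matrix.det hQ
  rw [Matrix.det_mul] at h3
  rw [Matrix.scalar_apply, Matrix.det_diagonal, Finset.prod_const, Finset.card_univ] at h3
  exact h3

lemma exists_charpoly_eq_cyclotomic_pow {M : Matrix ι ι ℤ} {d : ℕ} (hd : 0 < d)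
    (h : aeval M (cyclotomic d ℤ) = 0) :
    ∃ k, M.charpoly = cyclotomic d ℤ ^ k ∧ Fintype.card ι = d.totient * k := by
  have hp : Prime (cyclotomic d ℤ) := (cyclotomic.irreducible hd).prime
  obtain ⟨k, -, hk⟩ := (dvd_prime_pow hp _).mp (charpoly_dvd_pow_of_aeval_eq_zero M _ h)
  have hk' := eq_of_monic_of_associated M.charpoly_monic ((cyclotomic.monic d ℤ).pow k) hk
  refine ⟨k, hk', ?_⟩
  rw [← M.charpoly_natDegree_eq_dim, hk', natDegree_pow, natDegree_cyclotomic, mul_comm]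

lemma exists_natAbs_det_add_one {M : Matrix ι ι ℤ} {d : ℕ} (hd : 0 < d)
    (h : aeval M (cyclotomic d ℤ) = 0) :
    ∃ k, Fintype.card ι = d.totient * k ∧
      (M + 1).det.natAbs = ((cyclotomic d ℤ).eval (-1)).natAbs ^ k := by
  obtain ⟨k, hk, hc⟩ := exists_charpoly_eq_cyclotomic_pow hd h
  refine ⟨k, hc, ?_⟩
  have h1 := Matrix.eval_charpoly M (-1)
  rw [hk, eval_pow] at h1
  have h2 : Matrix.scalar ι (-1 : ℤ) - M = -(M + 1) := by
    rw [map_neg, map_one]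
    abel
  rw [h2, Matrix.det_neg] at h1
  rw [← Int.natAbs_pow, h1, Int.natAbs_mul, Int.natAbs_pow]
  simp

lemma aeval_pow_cyclotomic_of_not_dvd {M : Matrix ι ι ℤ} {d p : ℕ} (hp : p.Prime) (hd : ¬ p ∣ d)
    (h : aeval M (cyclotomic d ℤ) = 0) : aeval (M ^ p) (cyclotomic d ℤ) = 0 := by
  rw [← expand_aeval, cyclotomic_expand_eq_cyclotomic_mul hp hd, map_mul, h, mul_zero]

lemma aeval_pow_cyclotomic_of_mul {M : Matrix ι ι ℤ} {d p : ℕ} (hp : p.Prime) (hd : ¬ p ∣ d)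
    (h : aeval M (cyclotomic (d * p) ℤ) = 0) : aeval (M ^ p) (cyclotomic d ℤ) = 0 := by
  rw [← expand_aeval, cyclotomic_expand_eq_cyclotomic_mul hp hd, map_mul, h, zero_mul]

lemma pow_eq_neg_one_of_cyclotomic {M : Matrix ι ι ℤ} {q : ℕ} (hq : q.Prime) (h2 : q ≠ 2)
    (h : aeval M (cyclotomic (2 * q) ℤ) = 0) : M ^ q = -1 := by
  have h1 := aeval_pow_cyclotomic_of_mul hq
    (fun h => h2 ((Nat.prime_dvd_prime_iff_eq hq Nat.prime_two).mp h)) h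
  rw [cyclotomic_two, map_add, aeval_X, map_one] at h1
  exact eq_neg_of_add_eq_zero_left h1

lemma pow_eq_one_of_cyclotomic {M : Matrix ι ι ℤ} {q : ℕ} (hq : q.Prime)
    (h : aeval M (cyclotomic q ℤ) = 0) : M ^ q = 1 := by
  have h1 := aeval_pow_cyclotomic_of_mul (d := 1) hq hq.not_dvd_one
    (by rwa [one_mul])
  rw [cyclotomic_one, map_sub, aeval_X, map_one] at h1
  exact sub_eq_zero.mp h1

lemma eval_neg_one_cyclotomic_prime {q : ℕ} (hq : q.Prime) (h2 : q ≠ 2) :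
    (cyclotomic q ℤ).eval (-1) = 1 := by
  have : Fact q.Prime := ⟨hq⟩
  have h1 := congrArg (eval (-1)) (cyclotomic_prime_mul_X_sub_one ℤ q)
  simp only [eval_mul, eval_sub, eval_X, eval_one, eval_pow,
    (hq.odd_of_ne_two h2).neg_one_pow] at h1
  linarith

lemma eval_neg_one_cyclotomic_two_mul_prime {q : ℕ} (hq : q.Prime) (h2 : q ≠ 2) :
    (cyclotomic (2 * q) ℤ).eval (-1) = q := by
  have : Fact q.Prime := ⟨hq⟩
  have h1 := congrArg (eval (-1)) (cyclotomic_expand_eq_cyclotomic_mul Nat.prime_two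
    (fun h => h2 ((Nat.prime_dvd_prime_iff_eq Nat.prime_two hq).mp h).symm) ℤ)
  rw [expand_eval, eval_mul, eval_neg_one_cyclotomic_prime hq h2, mul_one, mul_comm q,
    neg_one_sq, eval_one_cyclotomic_prime] at h1
  exact h1.symm

lemma eval_neg_one_cyclotomic_mul_primes {q r : ℕ} (hq : q.Prime) (hr : r.Prime) (hq2 : q ≠ 2)
    (hr2 : r ≠ 2) (hqr : q ≠ r) : (cyclotomic (q * r) ℤ).eval (-1) = 1 := by
  have h1 := congrArg (eval (-1)) (cyclotomic_expand_eq_cyclotomic_mul hr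
    (fun h => hqr ((Nat.prime_dvd_prime_iff_eq hr hq).mp h).symm) ℤ)
  rw [expand_eval, eval_mul, eval_neg_one_cyclotomic_prime hq hq2, mul_one,
    (hr.odd_of_ne_two hr2).neg_one_pow, eval_neg_one_cyclotomic_prime hq hq2] at h1
  exact h1.symm

lemma cyclotomic_two_mul_prime_mul {q : ℕ} (hq : q.Prime) (h2 : q ≠ 2) :
    cyclotomic (2 * q) ℤ * (X + 1) = X ^ q + 1 := by
  have h1 := cyclotomic_expand_eq_cyclotomic_mul hq
    (fun h => h2 ((Nat.prime_dvd_prime_iff_eq hq Nat.prime_two).mp h)) ℤ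
  rw [cyclotomic_two] at h1
  rw [← h1]
  simp

lemma natAbs_det_one_add_one : ((1 : Matrix ι ι ℤ) + 1).det.natAbs = 2 ^ Fintype.card ι := by
  have h : (1 : Matrix ι ι ℤ) + 1 = (2 : ℤ) • (1 : Matrix ι ι ℤ) := (two_smul ℤ _).symm
  rw [h, Matrix.det_smul, Matrix.det_one, mul_one, Int.natAbs_pow]
  rfl

lemma natAbs_det_add_one_of_eval {M : Matrix ι ι ℤ} {d : ℕ} (hd : 0 < d)
    (h : aeval M (cyclotomic d ℤ) = 0) (he : (cyclotomic d ℤ).eval (-1) = 1) :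
    (M + 1).det.natAbs = 1 := by
  obtain ⟨k, -, hk⟩ := exists_natAbs_det_add_one hd h
  rw [hk, he, Int.natAbs_one, one_pow]

lemma natAbs_det_add_one_of_two_mul {M : Matrix ι ι ℤ} {q : ℕ} (hq : q.Prime) (hq2 : q ≠ 2)
    (h : aeval M (cyclotomic (2 * q) ℤ) = 0) :
    (M + 1).det.natAbs = q ^ (Fintype.card ι / (q - 1)) := by
  obtain ⟨k, hc, hk⟩ := exists_natAbs_det_add_one (by have := hq.pos; lia) h
  rw [hk, eval_neg_one_cyclotomic_two_mul_prime hq hq2, Int.natAbs_natCast, hc,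
    Nat.totient_mul ((Nat.coprime_primes Nat.prime_two hq).mpr hq2.symm), Nat.totient_two, one_mul,
    Nat.totient_prime hq, Nat.mul_div_cancel_left _ (by have := hq.two_le; lia)]

section

variable {q r : ℕ} (hq : q.Prime) (hr : r.Prime) (hq2 : q ≠ 2) (hr2 : r ≠ 2) (hqr : q ≠ r)
  {M : Matrix ι ι ℤ}
include hq hq2

lemma natAbs_det_cyclotomic_mul (M : Matrix ι ι ℤ) :
    (aeval M (cyclotomic (2 * q) ℤ)).det.natAbs * (M + 1).det.natAbs
      = (M ^ q + 1).det.natAbs := by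
  have h := congrArg (aeval M) (cyclotomic_two_mul_prime_mul hq hq2)
  simp only [map_mul, map_add, map_pow, aeval_X, map_one] at h
  rw [← h, Matrix.det_mul, Int.natAbs_mul]

lemma natAbs_det_cyclotomic_of_one (h : aeval M (cyclotomic 1 ℤ) = 0) :
    (aeval M (cyclotomic (2 * q) ℤ)).det.natAbs = 1 := by
  rw [cyclotomic_one, map_sub, aeval_X, map_one, sub_eq_zero] at h
  have h1 := natAbs_det_cyclotomic_mul hq hq2 M
  rw [h, one_pow, natAbs_det_one_add_one] at h1
  rw [h]
  exact Nat.eq_of_mul_eq_mul_right (by positivity) (h1.trans (one_mul _).symm)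

lemma natAbs_det_cyclotomic_of_two (h : aeval M (cyclotomic 2 ℤ) = 0) :
    (aeval M (cyclotomic (2 * q) ℤ)).det.natAbs = q ^ Fintype.card ι := by
  rw [cyclotomic_two, map_add, aeval_X, map_one] at h
  have h1 : M = algebraMap ℤ (Matrix ι ι ℤ) (-1) := by
    rw [map_neg, map_one]
    exact eq_neg_of_add_eq_zero_left h
  rw [h1, aeval_algebraMap_apply, coe_aeval_eq_eval, eval_neg_one_cyclotomic_two_mul_prime hq hq2,
    Algebra.algebraMap_eq_smul_one, Matrix.det_smul, Matrix.det_one, mul_one, Int.natAbs_pow,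
    Int.natAbs_natCast]

lemma natAbs_det_cyclotomic_of_self (h : aeval M (cyclotomic q ℤ) = 0) :
    (aeval M (cyclotomic (2 * q) ℤ)).det.natAbs = 2 ^ Fintype.card ι := by
  have h1 := natAbs_det_cyclotomic_mul hq hq2 M
  rwa [pow_eq_one_of_cyclotomic hq h, natAbs_det_one_add_one,
    natAbs_det_add_one_of_eval hq.pos h (eval_neg_one_cyclotomic_prime hq hq2), mul_one] at h1

include hr hr2 hqr

lemma natAbs_det_cyclotomic_of_ne (h : aeval M (cyclotomic r ℤ) = 0) :
    (aeval M (cyclotomic (2 * q) ℤ)).det.natAbs = 1 := by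
  have h1 := natAbs_det_cyclotomic_mul hq hq2 M
  have h2 := aeval_pow_cyclotomic_of_not_dvd hq
    (fun h => hqr ((Nat.prime_dvd_prime_iff_eq hq hr).mp h)) h
  rwa [natAbs_det_add_one_of_eval hr.pos h (eval_neg_one_cyclotomic_prime hr hr2),
    natAbs_det_add_one_of_eval hr.pos h2 (eval_neg_one_cyclotomic_prime hr hr2), mul_one] at h1

lemma natAbs_det_cyclotomic_of_mul (h : aeval M (cyclotomic (q * r) ℤ) = 0) :
    (aeval M (cyclotomic (2 * q) ℤ)).det.natAbs = 1 := by
  have h1 := natAbs_det_cyclotomic_mul hq hq2 M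
  have h2 := aeval_pow_cyclotomic_of_mul hq
    (fun h => hqr ((Nat.prime_dvd_prime_iff_eq hq hr).mp h)) (mul_comm q r ▸ h)
  rwa [natAbs_det_add_one_of_eval (Nat.mul_pos hq.pos hr.pos) h
    (eval_neg_one_cyclotomic_mul_primes hq hr hq2 hr2 hqr),
    natAbs_det_add_one_of_eval hr.pos h2 (eval_neg_one_cyclotomic_prime hr hr2), mul_one] at h1

lemma natAbs_det_cyclotomic_of_two_mul_ne (h : aeval M (cyclotomic (2 * r) ℤ) = 0) :
    (aeval M (cyclotomic (2 * q) ℤ)).det.natAbs = 1 := by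
  have h1 := natAbs_det_cyclotomic_mul hq hq2 M
  have h2 := aeval_pow_cyclotomic_of_not_dvd hq (fun h => (hq.dvd_mul.mp h).elim
    (fun h => hq2 ((Nat.prime_dvd_prime_iff_eq hq Nat.prime_two).mp h))
    (fun h => hqr ((Nat.prime_dvd_prime_iff_eq hq hr).mp h))) h
  rw [natAbs_det_add_one_of_two_mul hr hr2 h, natAbs_det_add_one_of_two_mul hr hr2 h2] at h1
  exact Nat.eq_of_mul_eq_mul_right (pow_pos hr.pos _) (h1.trans (one_mul _).symm)

lemma natAbs_det_pow_sub_one_mul_pow_add_one (h : aeval M (cyclotomic (2 * q) ℤ) = 0) :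
    (aeval M ((X ^ (q * r) - 1) * (X ^ r + 1) : ℤ[X])).det.natAbs
      = 2 ^ Fintype.card ι * q ^ (Fintype.card ι / (q - 1)) := by
  have h2 := aeval_pow_cyclotomic_of_not_dvd hr (fun h => (hr.dvd_mul.mp h).elim
    (fun h => hr2 ((Nat.prime_dvd_prime_iff_eq hr Nat.prime_two).mp h))
    (fun h => hqr ((Nat.prime_dvd_prime_iff_eq hr hq).mp h).symm)) h
  have h3 : (M ^ q) ^ r - 1 = -(1 + 1) := by
    rw [pow_eq_neg_one_of_cyclotomic hq hq2 h, (hr.odd_of_ne_two hr2).neg_one_pow]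
    abel
  simp only [map_mul, map_sub, map_add, map_pow, aeval_X, map_one, pow_mul, h3]
  rw [Matrix.det_mul, Int.natAbs_mul, natAbs_det_add_one_of_two_mul hq hq2 h2, Matrix.det_neg,
    Int.natAbs_mul, natAbs_det_one_add_one]
  simp [Int.natAbs_pow]

end

end CyclotomicMatrix

section LatticeIsometry

open Module Polynomial

lemma aeval_mem_of_forall_mem {E : Type*} [AddCommGroup E] [Module ℝ E] {L : Submodule ℤ E}
    {s : End ℝ E} (hs : ∀ x ∈ L, s x ∈ L) (p : ℤ[X]) {x : E} (hx : x ∈ L) : aeval s p x ∈ L := by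
  induction p using Polynomial.induction_on generalizing x with
  | C a => simpa [Module.algebraMap_end_apply] using L.smul_mem a hx
  | add p q hp hq => simpa using L.add_mem (hp hx) (hq hx)
  | monomial n a ih =>
    rw [pow_succ, ← mul_assoc, map_mul, aeval_X, Module.End.mul_apply]
    exact ih (hs x hx)

variable {E : Type*} [NormedAddCommGroup E] [InnerProductSpace ℝ E]

lemma aeval_cyclProd_mem_cyclKer {s : End ℝ E} {S T : Finset ℕ} (h : Disjoint S T)
    (h0 : aeval s (cyclProd (S ∪ T)) = 0) (x : E) : aeval s (cyclProd T) x ∈ cyclKer s S := by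
  rw [mem_cyclKer, ← Module.End.mul_apply, ← map_mul, ← cyclProd_union h, h0,
    LinearMap.zero_apply]

lemma cyclKer_le_range {s : End ℝ E} {S T : Finset ℕ} (h : Disjoint S T) {x : E}
    (hx : x ∈ cyclKer s S) : ∃ y, aeval s (cyclProd T) y = x := by
  obtain ⟨a, b, hab⟩ := exists_aeval_cyclProd_bezout h s
  refine ⟨aeval s b x, ?_⟩
  rw [← aeval_aeval_comm_real]
  conv_rhs => rw [← hab x, mem_cyclKer.mp hx, map_zero, zero_add]

lemma cyclKer_le_span {s : End ℝ E} {S T : Finset ℕ} (h : Disjoint S T)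
    (h0 : aeval s (cyclProd (S ∪ T)) = 0) {L : Submodule ℤ E}
    (hL : Submodule.span ℝ (L : Set E) = ⊤) (hs : ∀ x ∈ L, s x ∈ L) :
    cyclKer s S ≤ Submodule.span ℝ {x | x ∈ L ∧ x ∈ cyclKer s S} := by
  intro x hx
  obtain ⟨y, rfl⟩ := cyclKer_le_range h hx
  have h1 : y ∈ Submodule.span ℝ (L : Set E) := hL ▸ Submodule.mem_top
  have h2 := Submodule.mem_map_of_mem (f := aeval s (cyclProd T)) h1
  rw [Submodule.map_span] at h2
  refine Submodule.span_mono ?_ h2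
  rintro _ ⟨z, hz, rfl⟩
  exact ⟨aeval_mem_of_forall_mem hs _ hz, aeval_cyclProd_mem_cyclKer h h0 z⟩

lemma Commute.aeval_left {A R : Type*} [CommRing A] [Ring R] [Algebra A R] {a b : R}
    (h : Commute a b) (p : A[X]) : Commute (aeval a p) b := by
  rw [aeval_eq_sum_range]
  exact Commute.sum_left _ _ _ fun i _ => (h.pow_left i).smul_left _

variable [FiniteDimensional ℝ E]

lemma commute_aeval_adjoint {s : End ℝ E} (hs : ∀ x y, ⟪s x, s y⟫ = ⟪x, y⟫) (p : ℤ[X]) :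
    Commute (aeval s p) (LinearMap.adjoint (aeval s p)) := by
  have h1 : star s * s = 1 := by
    refine LinearMap.ext fun x => ext_inner_right ℝ fun y => ?_
    rw [LinearMap.star_eq_adjoint, Module.End.mul_apply, LinearMap.adjoint_inner_left, hs]
    rfl
  have h2 : Commute s (star s) := by
    rw [Commute, SemiconjBy, h1, mul_eq_one_comm.mp h1]
  have h3 : Commute s (star (aeval s p)) := by
    have := (h2.aeval_left p).star_star
    rw [star_star] at this
    exact this.symm
  exact h3.aeval_left p

lemma orthogonal_cyclKer {s : End ℝ E} (hs : ∀ x y, ⟪s x, s y⟫ = ⟪x, y⟫) {S T : Finset ℕ}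
    (h : Disjoint S T) (h0 : aeval s (cyclProd (S ∪ T)) = 0) :
    (cyclKer s S)ᗮ = cyclKer s T := by
  have h1 : cyclKer s S = LinearMap.range (aeval s (cyclProd T)) := by
    refine le_antisymm (fun x hx => cyclKer_le_range h hx) ?_
    rintro _ ⟨x, rfl⟩
    exact aeval_cyclProd_mem_cyclKer h h0 x
  have h2 := (commute_aeval_adjoint hs (cyclProd T)).eq
  rw [h1, LinearMap.orthogonal_range, ← LinearMap.ker_self_comp_adjoint, ← Module.End.mul_eq_comp,
    h2, Module.End.mul_eq_comp, LinearMap.ker_adjoint_comp_self, cyclKer]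

end LatticeIsometry

section CyclotomicGram

open Module Polynomial

variable {E : Type*} [NormedAddCommGroup E] [InnerProductSpace ℝ E] [FiniteDimensional ℝ E]
  {L : Submodule ℤ E} [DiscreteTopology L] [IsZLattice ℝ L] {s : End ℝ E}

lemma exists_int_toMatrix_cyclRes (hs : ∀ x ∈ L, s x ∈ L) {S T : Finset ℕ} (h : Disjoint S T)
    (h0 : aeval s (cyclProd (S ∪ T)) = 0) :
    ∃ (β : Basis (Fin (finrank ℝ (cyclKer s S))) ℝ (cyclKer s S))
      (M : Matrix (Fin (finrank ℝ (cyclKer s S))) (Fin (finrank ℝ (cyclKer s S))) ℤ),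
      LinearMap.toMatrix β β (cyclRes s S) = M.map (Int.cast : ℤ → ℝ) ∧
      aeval M (cyclProd S) = 0 := by
  obtain ⟨n, k, B, β, -, -, hβ⟩ := exists_basis_adapted L (cyclKer s S)
    (cyclKer_le_span h h0 IsZLattice.span_top hs)
  obtain rfl : n = finrank ℝ (cyclKer s S) := by
    rw [finrank_eq_card_basis β, Fintype.card_fin]
  obtain ⟨M, hM⟩ := exists_int_toMatrix β (cyclRes s S) fun x hx =>
    (hβ _).mp (hs _ ((hβ x).mpr hx))
  refine ⟨β, M, hM, ?_⟩
  have h1 := toMatrix_aeval_eq_map_aeval β _ M hM (cyclProd S)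
  rw [aeval_cyclRes_cyclProd, map_zero] at h1
  ext i j
  have h2 := congrFun (congrFun h1 i) j
  simpa using h2.symm

theorem exists_int_dvd_det_cyclRes [MeasurableSpace E] [BorelSpace E]
    (hL : ∀ x, x ∈ L ↔ ∀ y ∈ L, ∃ k : ℤ, ⟪x, y⟫ = (k : ℝ))
    (hmin : ∀ x ∈ L, x ≠ 0 → 6 ≤ ⟪x, x⟫) (hs : ∀ x ∈ L, s x ∈ L)
    (hiso : ∀ x y, ⟪s x, s y⟫ = ⟪x, y⟫) {S T : Finset ℕ} (h : Disjoint S T)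
    (h0 : aeval s (cyclProd (S ∪ T)) = 0) :
    ∃ D : ℤ, (∃ a : ℤ, LinearMap.det (aeval (cyclRes s S) (cyclProd T)) = D * a) ∧
      (∃ a : ℤ, LinearMap.det (aeval (cyclRes s T) (cyclProd S)) = D * a) ∧
      ∀ k, 0 < k → finrank ℝ (cyclKer s S) = 2 * k →
        ((3 * Real.pi) ^ k / (k + 1).factorial) ^ 2 ≤ (D : ℝ) := by
  obtain ⟨n, β, D, hβ, hD, h1, h2⟩ := exists_basis_gram_det_dvd L hL (cyclKer s S) (cyclKer s T)
    (orthogonal_cyclKer hiso h h0) (cyclKer_le_span h h0 IsZLattice.span_top hs)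
  refine ⟨D, h1 (aeval s (cyclProd T)) _ (fun x => aeval_mem_of_forall_mem hs _)
    (fun x hx => hx) (aeval_cyclProd_mem_cyclKer h h0) (fun x => coe_aeval_cyclRes _ _ _ _),
    h2 (aeval s (cyclProd S)) _ (fun x => aeval_mem_of_forall_mem hs _) (fun x hx => hx)
    (aeval_cyclProd_mem_cyclKer h.symm (Finset.union_comm S T ▸ h0))
    (fun x => coe_aeval_cyclRes _ _ _ _), fun k hk hkn => ?_⟩
  rw [← hD]
  refine blichfeldt_le_det_gram β hk ?_ fun x hx hx0 => hmin x ((hβ x).mpr hx) ?_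
  · rw [← hkn, finrank_eq_card_basis β]
  · simpa using hx0

lemma exists_int_toMatrix_cyclRes_singleton (hs : ∀ x ∈ L, s x ∈ L) {W : Finset ℕ}
    (h0 : aeval s (cyclProd W) = 0) {d : ℕ} (hd : d ∈ W) :
    ∃ (β : Basis (Fin (finrank ℝ (cyclKer s {d}))) ℝ (cyclKer s {d}))
      (M : Matrix (Fin (finrank ℝ (cyclKer s {d}))) (Fin (finrank ℝ (cyclKer s {d}))) ℤ),
      LinearMap.toMatrix β β (cyclRes s {d}) = M.map (Int.cast : ℤ → ℝ) ∧
      aeval M (cyclotomic d ℤ) = 0 := by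
  rw [← cyclProd_singleton]
  exact exists_int_toMatrix_cyclRes hs (T := W \ {d}) Finset.disjoint_sdiff
    (by rwa [Finset.union_sdiff_of_subset (by simpa using hd)])

lemma exists_int_matrix_cyclRes_singleton (hs : ∀ x ∈ L, s x ∈ L) {W : Finset ℕ}
    (h0 : aeval s (cyclProd W) = 0) {d : ℕ} (hd : d ∈ W) :
    ∃ M : Matrix (Fin (finrank ℝ (cyclKer s {d}))) (Fin (finrank ℝ (cyclKer s {d}))) ℤ,
      aeval M (cyclotomic d ℤ) = 0 ∧
      ∀ p : ℤ[X], LinearMap.det (aeval (cyclRes s {d}) p) = ((aeval M p).det : ℝ) := by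
  obtain ⟨β, M, hM, hM0⟩ := exists_int_toMatrix_cyclRes_singleton hs h0 hd
  refine ⟨M, hM0, fun p => ?_⟩
  rw [← LinearMap.det_toMatrix β, toMatrix_aeval_eq_map_aeval β _ M hM]
  exact ((Int.castRingHom ℝ).map_det _).symm

lemma totient_dvd_finrank_cyclKer (hs : ∀ x ∈ L, s x ∈ L) {W : Finset ℕ}
    (h0 : aeval s (cyclProd W) = 0) {d : ℕ} (hd0 : 0 < d) (hd : d ∈ W) :
    d.totient ∣ finrank ℝ (cyclKer s {d}) := by
  obtain ⟨M, hM, -⟩ := exists_int_matrix_cyclRes_singleton hs h0 hd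
  obtain ⟨k, -, hk⟩ := exists_charpoly_eq_cyclotomic_pow hd0 hM
  exact ⟨k, by rw [← hk, Fintype.card_fin]⟩

lemma dvd_pow_min_mul_pow_min {x y D a b c d : ℕ} (h : x.Coprime y) (h1 : D ∣ x ^ a * y ^ b)
    (h2 : D ∣ x ^ c * y ^ d) : D ∣ x ^ min a c * y ^ min b d := by
  obtain ⟨u, v, hu, hv, rfl⟩ := Nat.dvd_mul.mp h1
  have hu' : u ∣ x ^ c := (Nat.Coprime.of_dvd_left hu (h.pow a d)).dvd_of_dvd_mul_right
    ((dvd_mul_right u v).trans h2)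
  have hv' : v ∣ y ^ d := (Nat.Coprime.of_dvd_left hv (h.symm.pow b c)).dvd_of_dvd_mul_left
    ((dvd_mul_left v u).trans h2)
  refine mul_dvd_mul ?_ ?_
  · rcases min_choice a c with h | h <;> rwa [h]
  · rcases min_choice b d with h | h <;> rwa [h]

lemma divisors_mul_primes {q r : ℕ} (hq : q.Prime) (hr : r.Prime) :
    (q * r).divisors = {1, q, r, q * r} := by
  rw [Nat.divisors_mul, hq.divisors, hr.divisors]
  ext d
  simp [Finset.mem_mul]
  tauto

@[to_additive sum_divisors_mul_primes]
lemma prod_divisors_mul_primes {q r : ℕ} (hq : q.Prime) (hr : r.Prime) (hqr : q ≠ r)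
    {R : Type*} [CommMonoid R] (f : ℕ → R) :
    ∏ d ∈ (q * r).divisors, f d = f 1 * (f q * (f r * f (q * r))) := by
  have := hq.two_le
  have := hr.two_le
  have h1 : 1 ≠ q * r := fun h => by nlinarith
  have h2 : 1 ≠ q := by lia
  have h3 : 1 ≠ r := by lia
  have h4 : q ≠ q * r := fun h => by nlinarith
  have h5 : r ≠ q * r := fun h => by nlinarith
  rw [divisors_mul_primes hq hr, Finset.prod_insert (by simp [*]), Finset.prod_insert (by simp [*]),
    Finset.prod_insert (by simp [*]), Finset.prod_singleton]

section

variable {q r : ℕ} (hq : q.Prime) (hr : r.Prime) (hq2 : q ≠ 2) (hr2 : r ≠ 2) (hqr : q ≠ r)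
include hq hr hq2 hr2 hqr

@[to_additive sum_divisors_two_mul_primes]
lemma prod_divisors_two_mul_primes {R : Type*} [CommMonoid R] (f : ℕ → R) :
    ∏ d ∈ {1, q, r, q * r, 2, 2 * r}, f d
      = f 1 * (f q * (f r * (f (q * r) * (f 2 * f (2 * r))))) := by
  have := hq.two_le
  have := hr.two_le
  have h1 : q * r ≠ 2 := fun h => by nlinarith
  have h2 : 1 ≠ q * r := fun h => by nlinarith
  have h3 : q ≠ 2 * r := fun h => hqr ((Nat.prime_dvd_prime_iff_eq hr hq).mp ⟨2, by lia⟩).symm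
  have h4 : 1 ≠ q := by lia
  have h5 : 1 ≠ r := by lia
  have h6 : 1 ≠ 2 * r := by lia
  have h7 : r ≠ 2 * r := by lia
  have h8 : 2 ≠ 2 * r := by lia
  have h9 : q ≠ q * r := fun h => by nlinarith
  have h10 : r ≠ q * r := fun h => by nlinarith
  have h11 : q * r ≠ 2 * r := fun h => hq2 (Nat.eq_of_mul_eq_mul_right hr.pos h)
  rw [Finset.prod_insert (by simp [*]), Finset.prod_insert (by simp [*]),
    Finset.prod_insert (by simp [*]), Finset.prod_insert (by simp [*]),
    Finset.prod_insert (by simpa using h8), Finset.prod_singleton]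

lemma disjoint_two_mul_prime : Disjoint {2 * q} ({1, q, r, q * r, 2, 2 * r} : Finset ℕ) := by
  have := hq.two_le
  have := hr.two_le
  have h1 : 2 * q ≠ r := fun h => hqr ((Nat.prime_dvd_prime_iff_eq hq hr).mp ⟨2, by lia⟩)
  have h2 : 2 * q ≠ q * r := fun h => hr2 (Nat.eq_of_mul_eq_mul_left hq.pos (by lia))
  simp only [Finset.disjoint_singleton_left, Finset.mem_insert, Finset.mem_singleton]
  lia

lemma cyclProd_two_mul_primes :
    cyclProd {1, q, r, q * r, 2, 2 * r} = (X ^ (q * r) - 1) * (X ^ r + 1) := by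
  rw [cyclProd, prod_divisors_two_mul_primes hq hr hq2 hr2 hqr,
    ← cyclotomic_two_mul_prime_mul hr hr2, ← cyclProd_divisors (Nat.mul_pos hq.pos hr.pos),
    cyclProd, prod_divisors_mul_primes hq hr hqr, cyclotomic_two]
  ring

theorem pow_le_of_cyclProd_eq_zero [MeasurableSpace E] [BorelSpace E]
    (hL : ∀ x, x ∈ L ↔ ∀ y ∈ L, ∃ k : ℤ, ⟪x, y⟫ = (k : ℝ))
    (hmin : ∀ x ∈ L, x ≠ 0 → 6 ≤ ⟪x, x⟫) (hs : ∀ x ∈ L, s x ∈ L)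
    (hiso : ∀ x y, ⟪s x, s y⟫ = ⟪x, y⟫)
    (h0 : aeval s (cyclProd ({2 * q} ∪ {1, q, r, q * r, 2, 2 * r})) = 0) {k : ℕ} (hk : 0 < k)
    (hn : finrank ℝ (cyclKer s {2 * q}) = 2 * k) :
    942 ^ (2 * k) ≤ 2 ^ min (2 * k) (finrank ℝ (cyclKer s {q})) *
      q ^ min (2 * k / (q - 1)) (finrank ℝ (cyclKer s {2})) * (k + 1).factorial ^ 2
        * 100 ^ (2 * k) := by
  obtain ⟨D, ⟨a, ha⟩, ⟨b, hb⟩, hD⟩ := exists_int_dvd_det_cyclRes hL hmin hs hiso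
    (disjoint_two_mul_prime hq hr hq2 hr2 hqr) h0
  have hmat := fun d (hd : d ∈ {2 * q} ∪ ({1, q, r, q * r, 2, 2 * r} : Finset ℕ)) =>
    exists_int_matrix_cyclRes_singleton hs h0 hd
  have h1 : D.natAbs ∣ 2 ^ (2 * k) * q ^ (2 * k / (q - 1)) := by
    obtain ⟨M, hM, hMd⟩ := hmat (2 * q) (by simp)
    have h2 := natAbs_det_pow_sub_one_mul_pow_add_one hq hr hq2 hr2 hqr hM
    simp only [Fintype.card_fin, hn] at h2
    rw [hMd, cyclProd_two_mul_primes hq hr hq2 hr2 hqr, ← Int.cast_mul, Int.cast_inj] at ha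
    rw [← h2, ha, Int.natAbs_mul]
    exact dvd_mul_right _ _
  have h3 : D.natAbs ∣ 2 ^ finrank ℝ (cyclKer s {q}) * q ^ finrank ℝ (cyclKer s {2}) := by
    obtain ⟨M₁, hM₁, hd₁⟩ := hmat 1 (by simp)
    obtain ⟨M₂, hM₂, hd₂⟩ := hmat q (by simp)
    obtain ⟨M₃, hM₃, hd₃⟩ := hmat r (by simp)
    obtain ⟨M₄, hM₄, hd₄⟩ := hmat (q * r) (by simp)
    obtain ⟨M₅, hM₅, hd₅⟩ := hmat 2 (by simp)
    obtain ⟨M₆, hM₆, hd₆⟩ := hmat (2 * r) (by simp)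
    rw [det_aeval_cyclRes, prod_divisors_two_mul_primes hq hr hq2 hr2 hqr, cyclProd_singleton,
      hd₁, hd₂, hd₃, hd₄, hd₅, hd₆] at hb
    simp only [← Int.cast_mul, Int.cast_inj] at hb
    have h4 := congrArg Int.natAbs hb
    simp only [Int.natAbs_mul, natAbs_det_cyclotomic_of_one hq hq2 hM₁,
      natAbs_det_cyclotomic_of_self hq hq2 hM₂, natAbs_det_cyclotomic_of_two hq hq2 hM₅,
      natAbs_det_cyclotomic_of_ne hq hr hq2 hr2 hqr hM₃,
      natAbs_det_cyclotomic_of_mul hq hr hq2 hr2 hqr hM₄,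
      natAbs_det_cyclotomic_of_two_mul_ne hq hr hq2 hr2 hqr hM₆, one_mul, mul_one,
      Fintype.card_fin] at h4
    exact ⟨_, h4⟩
  have h5 : D.natAbs ≤ 2 ^ min (2 * k) (finrank ℝ (cyclKer s {q})) *
      q ^ min (2 * k / (q - 1)) (finrank ℝ (cyclKer s {2})) := by
    refine Nat.le_of_dvd (Nat.mul_pos (by positivity) (pow_pos hq.pos _)) ?_
    exact dvd_pow_min_mul_pow_min ((Nat.coprime_primes Nat.prime_two hq).mpr hq2.symm) h1 h3
  have h10 := hD k hk hn
  have h11 : ((942 / 100 : ℝ) ^ k / (k + 1).factorial) ^ 2 ≤ D.natAbs := by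
    calc ((942 / 100 : ℝ) ^ k / (k + 1).factorial) ^ 2
        ≤ ((3 * Real.pi) ^ k / (k + 1).factorial) ^ 2 := by
          have := Real.pi_gt_d2
          gcongr
          linarith
      _ ≤ (D : ℝ) := h10
      _ ≤ D.natAbs := by
          rw [Nat.cast_natAbs, Int.cast_abs]
          exact le_abs_self _
  rw [div_pow, div_pow, div_pow, ← pow_mul, ← pow_mul, div_le_iff₀ (by positivity),
    div_le_iff₀ (by positivity), mul_comm k 2] at h11
  have h12 : 942 ^ (2 * k) ≤ D.natAbs * (k + 1).factorial ^ 2 * 100 ^ (2 * k) := by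
    exact_mod_cast h11
  exact h12.trans (by gcongr)

end

end CyclotomicGram

section DimensionArithmetic

/-- No dimension vector of the eigenspaces of an automorphism of order `2 * q * r` satisfies
the constraints coming from fixed spaces and from the determinants of two eigenlattices. -/
def NoDimensionVector (q r : ℕ) : Prop :=
  ∀ i ∈ Finset.range (24 / (q - 1) + 1), ∀ j ∈ Finset.range (24 / (r - 1) + 1), 0 < i → 0 < j →
    (q - 1) * i + (r - 1) * j ≤ 24 →
    ∀ w ∈ Finset.range (24 / ((q - 1) * (r - 1)) + 1), 0 < w →
    ∀ u ∈ Finset.range (24 / (q - 1) + 1), (q - 1) * u + (q - 1) * (r - 1) * w ≤ 24 →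
    24 - (q - 1) * i + (24 - (q - 1) * u - (q - 1) * (r - 1) * w) ≤ 22 →
    942 ^ ((q - 1) * i) ≤ 2 ^ min ((q - 1) * i) ((q - 1) * u) *
      q ^ min i (24 - (q - 1) * i - (r - 1) * j) * ((q - 1) * i / 2 + 1).factorial ^ 2
        * 100 ^ ((q - 1) * i) →
    ∀ v ∈ Finset.range (24 / (r - 1) + 1), (q - 1) * u + (r - 1) * v + (q - 1) * (r - 1) * w ≤ 24 →
    24 - (r - 1) * j + (24 - (r - 1) * v - (q - 1) * (r - 1) * w) ≤ 22 →
    ¬ 942 ^ ((r - 1) * j) ≤ 2 ^ min ((r - 1) * j) ((r - 1) * v) *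
      r ^ min j (24 - (q - 1) * i - (r - 1) * j) * ((r - 1) * j / 2 + 1).factorial ^ 2
        * 100 ^ ((r - 1) * j)

instance (q r : ℕ) : Decidable (NoDimensionVector q r) := by
  unfold NoDimensionVector
  infer_instance

lemma noDimensionVector_three_five : NoDimensionVector 3 5 := by decide +kernel
lemma noDimensionVector_three_seven : NoDimensionVector 3 7 := by decide +kernel
lemma noDimensionVector_three_eleven : NoDimensionVector 3 11 := by decide +kernel
lemma noDimensionVector_three_thirteen : NoDimensionVector 3 13 := by decide +kernel
lemma noDimensionVector_five_seven : NoDimensionVector 5 7 := by decide +kernel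

lemma exists_two_mul_primes_of_totient_le {m : ℕ} (hm : Squarefree m) (hm1 : m ≠ 1)
    (hmp : ¬ m.Prime) (hmpq : ∀ p q, p.Prime → q.Prime → p ≠ q → m ≠ p * q)
    (h24 : ∀ p, p.Prime → p ∣ m → (m / p).totient ≤ 24)
    (h22 : ∀ p, p.Prime → p ≠ 2 → p ∣ m → (m / p).totient ≤ 22) :
    ∃ q r, q.Prime ∧ r.Prime ∧ q ≠ 2 ∧ r ≠ 2 ∧ q ≠ r ∧ NoDimensionVector q r ∧ m = 2 * q * r := by
  have step : ∀ n, Squarefree n → n ≠ 1 → ∃ p k, p.Prime ∧ n = p * k ∧ Squarefree k ∧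
      p.Coprime k ∧ ∀ l, l.Prime → l ∣ k → p < l := by
    intro n hn hn1
    have hp := Nat.minFac_prime hn1
    obtain ⟨k, hk⟩ := Nat.minFac_dvd n
    have hcop : n.minFac.Coprime k := Nat.coprime_of_squarefree_mul (hk ▸ hn)
    refine ⟨_, k, hp, hk, hn.squarefree_of_dvd ⟨n.minFac, by rw [mul_comm]; exact hk⟩, hcop,
      fun l hl hlk => lt_of_le_of_ne (Nat.minFac_le_of_dvd hl.two_le ?_) fun h => ?_⟩
    · exact hk ▸ hlk.mul_left _
    · rw [← h] at hlk
      exact hp.one_lt.ne' (Nat.eq_one_of_dvd_coprimes hcop dvd_rfl hlk)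
  obtain ⟨p, k, hp, rfl, hk, hpk, hpl⟩ := step m hm hm1
  have hk1 : k ≠ 1 := by
    rintro rfl
    exact hmp (by rwa [mul_one])
  obtain ⟨q, l, hq, rfl, hl, hql, hqlt⟩ := step k hk hk1
  have hpq := hpl q hq (dvd_mul_right _ _)
  have hl1 : l ≠ 1 := by
    rintro rfl
    exact hmpq p q hp hq hpq.ne (by rw [mul_one])
  obtain ⟨r, n, hr, rfl, hn, hrn, hrlt⟩ := step l hl hl1
  have hqr := hqlt r hr (dvd_mul_right _ _)
  have h1 : (q * (r * n)).totient = (q - 1) * ((r - 1) * n.totient) := by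
    rw [Nat.totient_mul hql, Nat.totient_mul hrn, Nat.totient_prime hq, Nat.totient_prime hr]
  have h2 := h24 p hp (dvd_mul_right _ _)
  rw [Nat.mul_div_cancel_left _ hp.pos, h1] at h2
  have hp2 := hp.two_le
  have hq4 : q ≠ 4 := by rintro rfl; revert hq; decide
  have hr4 : r ≠ 4 := by rintro rfl; revert hr; decide
  have hr6 : r ≠ 6 := by rintro rfl; revert hr; decide
  have hn1 : n = 1 := by
    by_contra hn1
    obtain ⟨t, n', ht, rfl, -, htn, -⟩ := step n hn hn1
    have hrt := hrlt t ht (dvd_mul_right _ _)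
    have ht6 : t ≠ 6 := by rintro rfl; revert ht; decide
    rw [Nat.totient_mul htn, Nat.totient_prime ht] at h2
    have h3 : 0 < n'.totient := Nat.totient_pos.mpr (Nat.pos_of_ne_zero (by
      rintro rfl
      simp at hn))
    have h4 : 2 ≤ q - 1 := by lia
    have h5 : 4 ≤ r - 1 := by lia
    have h6 : 6 ≤ t - 1 := by lia
    have h7 := Nat.mul_le_mul h4 (Nat.mul_le_mul h5 (Nat.mul_le_mul h6 h3))
    lia
  subst hn1
  rw [Nat.totient_one, mul_one] at h2
  have hp2' : p = 2 := by
    by_contra hp2'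
    have h3 := h22 p hp hp2' (dvd_mul_right _ _)
    rw [Nat.mul_div_cancel_left _ hp.pos, h1, Nat.totient_one, mul_one] at h3
    have h4 : 4 ≤ q - 1 := by lia
    have h5 : 6 ≤ r - 1 := by lia
    have h6 := Nat.mul_le_mul h4 h5
    lia
  subst hp2'
  refine ⟨q, r, hq, hr, by lia, by lia, by lia, ?_, by ring⟩
  have hq7 : q < 7 := by
    by_contra! h
    have := Nat.mul_le_mul (show 6 ≤ q - 1 by lia) (show 7 ≤ r - 1 by lia)
    lia
  have hr14 : r < 14 := by
    by_contra! h
    have := Nat.mul_le_mul (show 2 ≤ q - 1 by lia) (show 13 ≤ r - 1 by lia)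
    lia
  have key : ∀ q ∈ Finset.range 7, ∀ r ∈ Finset.range 14, 2 < q → q < r →
      (q - 1) * (r - 1) ≤ 24 → q.Prime → r.Prime →
      q = 3 ∧ (r = 5 ∨ r = 7 ∨ r = 11 ∨ r = 13) ∨ q = 5 ∧ r = 7 := by decide
  rcases key q (by simpa using hq7) r (by simpa using hr14) hpq hqr h2 hq hr with
    ⟨rfl, rfl | rfl | rfl | rfl⟩ | ⟨rfl, rfl⟩
  exacts [noDimensionVector_three_five, noDimensionVector_three_seven,
    noDimensionVector_three_eleven, noDimensionVector_three_thirteen,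
    noDimensionVector_five_seven]

end DimensionArithmetic

section CyclotomicKernelNeBot

open Module Polynomial

section

variable {E : Type*} [AddCommGroup E] [Module ℝ E] {s : End ℝ E}

lemma cyclKer_pow_one {j : ℕ} (hj : 0 < j) : cyclKer (s ^ j) {1} = cyclKer s j.divisors := by
  rw [cyclKer, cyclKer, cyclProd_singleton, cyclProd_divisors hj, cyclotomic_one]
  simp

lemma mem_cyclKer_singleton {d : ℕ} {x : E} :
    x ∈ cyclKer s {d} ↔ aeval s (cyclotomic d ℤ) x = 0 := by
  rw [mem_cyclKer, cyclProd_singleton]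

lemma cyclKer_pow_of_dvd {n p : ℕ} (hp : p.Prime) (h : p ∣ n) :
    cyclKer (s ^ p) {n} = cyclKer s {n * p} := by
  ext x
  rw [mem_cyclKer_singleton, mem_cyclKer_singleton, ← expand_aeval,
    cyclotomic_expand_eq_cyclotomic hp h]

lemma cyclKer_pow_of_not_dvd {n p : ℕ} (hp : p.Prime) (h : ¬ p ∣ n)
    (hbot : cyclKer s {n * p} = ⊥) : cyclKer (s ^ p) {n} ≤ cyclKer s {n} := by
  intro x hx
  rw [mem_cyclKer_singleton, ← expand_aeval, cyclotomic_expand_eq_cyclotomic_mul hp h, map_mul,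
    Module.End.mul_apply, ← mem_cyclKer_singleton, hbot, Submodule.mem_bot] at hx
  exact mem_cyclKer_singleton.mpr hx

lemma aeval_cyclProd_properDivisors {m : ℕ} (hm : 0 < m) (hs : s ^ m = 1)
    (hbot : cyclKer s {m} = ⊥) : aeval s (cyclProd m.properDivisors) = 0 := by
  ext x
  have h1 : cyclProd m.divisors = cyclotomic m ℤ * cyclProd m.properDivisors := by
    rw [← Nat.cons_self_properDivisors hm.ne', cyclProd, Finset.prod_cons, cyclProd]
  have h2 : aeval s (cyclProd m.divisors) x = 0 := by
    rw [cyclProd_divisors hm]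
    simp [hs]
  rwa [h1, map_mul, Module.End.mul_apply, ← mem_cyclKer_singleton, hbot, Submodule.mem_bot] at h2

end

lemma properDivisors_two_mul_primes {q r : ℕ} (hq : q.Prime) (hr : r.Prime) (hq2 : q ≠ 2)
    (hr2 : r ≠ 2) :
    (2 * q * r).properDivisors = {2 * q} ∪ {1, q, r, q * r, 2, 2 * r} := by
  have h1 := hq.two_le
  have h2 := hr.two_le
  have h3 := Nat.mul_le_mul_left q (show 3 ≤ r by lia)
  have h4 := Nat.mul_le_mul_right r (show 3 ≤ q by lia)
  have h5 : (2 * q * r).divisors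
      = insert (2 * q * r) ({2 * q} ∪ {1, q, r, q * r, 2, 2 * r}) := by
    rw [mul_assoc, Nat.divisors_mul, divisors_mul_primes hq hr, Nat.prime_two.divisors]
    ext d
    simp [Finset.mem_mul]
    tauto
  have h6 : 2 * q * r ∉ ({2 * q} ∪ {1, q, r, q * r, 2, 2 * r} : Finset ℕ) := by
    simp only [Finset.mem_union, Finset.mem_insert, Finset.mem_singleton, mul_assoc]
    lia
  rw [← Finset.erase_insert h6, ← h5, ← Nat.insert_self_properDivisors (by lia),
    Finset.erase_insert Nat.self_notMem_properDivisors]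

variable {E : Type*} [NormedAddCommGroup E] [InnerProductSpace ℝ E] [FiniteDimensional ℝ E]
  [MeasurableSpace E] [BorelSpace E]
  {L : Submodule ℤ E} [DiscreteTopology L] [IsZLattice ℝ L]

/-- An endomorphism preserving both the inner product and the lattice. -/
def IsLatticeIsometry (L : Submodule ℤ E) (s : End ℝ E) : Prop :=
  (∀ x y, ⟪s x, s y⟫ = ⟪x, y⟫) ∧ ∀ x ∈ L, s x ∈ L

omit [FiniteDimensional ℝ E] [MeasurableSpace E] [BorelSpace E] [DiscreteTopology L]
  [IsZLattice ℝ L] in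
lemma IsLatticeIsometry.pow {s : End ℝ E} (hs : IsLatticeIsometry L s) (j : ℕ) :
    IsLatticeIsometry L (s ^ j) := by
  induction j with
  | zero => exact ⟨fun x y => rfl, fun x hx => hx⟩
  | succ j ih =>
    rw [pow_succ]
    exact ⟨fun x y => (ih.1 _ _).trans (hs.1 x y), fun x hx => ih.2 _ (hs.2 x hx)⟩

section

variable {q r : ℕ} {s : End ℝ E}

lemma false_of_noDimensionVector
    (hL : ∀ x, x ∈ L ↔ ∀ y ∈ L, ∃ k : ℤ, ⟪x, y⟫ = (k : ℝ))
    (hmin : ∀ x ∈ L, x ≠ 0 → 6 ≤ ⟪x, x⟫) (hs : IsLatticeIsometry L s) (hE : finrank ℝ E = 48)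
    (hq : q.Prime) (hr : r.Prime) (hq2 : q ≠ 2) (hr2 : r ≠ 2) (hqr : q ≠ r)
    (hN : NoDimensionVector q r) (h0 : aeval s (cyclProd (2 * q * r).properDivisors) = 0)
    (h24 : finrank ℝ (cyclKer s (q * r).divisors) = 24)
    (hq22 : finrank ℝ (cyclKer s (2 * q).divisors) ≤ 22)
    (hr22 : finrank ℝ (cyclKer s (2 * r).divisors) ≤ 22)
    (hqpos : cyclKer s {2 * q} ≠ ⊥) (hrpos : cyclKer s {2 * r} ≠ ⊥)
    (hqrpos : cyclKer s {q * r} ≠ ⊥) : False := by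
  have hW := properDivisors_two_mul_primes hq hr hq2 hr2
  have hW' : (2 * q * r).properDivisors = {2 * r} ∪ {1, r, q, r * q, 2, 2 * q} := by
    rw [← properDivisors_two_mul_primes hr hq hr2 hq2]
    congr 1
    ring
  have hdvd := fun d hd hd' => totient_dvd_finrank_cyclKer hs.2 h0 (d := d) hd hd'
  have htot : finrank ℝ (cyclKer s (2 * q * r).properDivisors) = 48 := by
    rw [cyclKer, h0, LinearMap.ker_zero, finrank_top, hE]
  have hcop : ∀ {p}, p.Prime → p ≠ 2 → (2 * p).totient = p - 1 := fun {p} hp hp2 => by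
    rw [Nat.totient_mul ((Nat.coprime_primes Nat.prime_two hp).mpr hp2.symm), Nat.totient_two,
      one_mul, Nat.totient_prime hp]
  obtain ⟨i, hi⟩ := hdvd (2 * q) (by have := hq.pos; lia) (by rw [hW]; simp)
  obtain ⟨j, hj⟩ := hdvd (2 * r) (by have := hr.pos; lia) (by rw [hW]; simp)
  obtain ⟨u, hu⟩ := hdvd q hq.pos (by rw [hW]; simp)
  obtain ⟨v, hv⟩ := hdvd r hr.pos (by rw [hW]; simp)
  obtain ⟨w, hw⟩ := hdvd (q * r) (Nat.mul_pos hq.pos hr.pos) (by rw [hW]; simp)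
  rw [hcop hq hq2] at hi
  rw [hcop hr hr2] at hj
  rw [Nat.totient_prime hq] at hu
  rw [Nat.totient_prime hr] at hv
  rw [Nat.totient_mul ((Nat.coprime_primes hq hr).mpr hqr), Nat.totient_prime hq,
    Nat.totient_prime hr] at hw
  rw [← Submodule.one_le_finrank_iff] at hqpos hrpos hqrpos
  rw [hi] at hqpos
  rw [hj] at hrpos
  rw [hw] at hqrpos
  have hq1 : 0 < q - 1 := Nat.sub_pos_of_lt hq.one_lt
  have hr1 : 0 < r - 1 := Nat.sub_pos_of_lt hr.one_lt
  rw [finrank_cyclKer, hW, Finset.sum_union (disjoint_two_mul_prime hq hr hq2 hr2 hqr),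
    Finset.sum_singleton, sum_divisors_two_mul_primes hq hr hq2 hr2 hqr, hi, hj, hu, hv, hw] at htot
  rw [finrank_cyclKer, sum_divisors_mul_primes hq hr hqr, hu, hv, hw] at h24
  rw [finrank_cyclKer, sum_divisors_mul_primes Nat.prime_two hq hq2.symm, hi, hu] at hq22
  rw [finrank_cyclKer, sum_divisors_mul_primes Nat.prime_two hr hr2.symm, hj, hv] at hr22
  have hbound : ∀ {p l : ℕ}, p.Prime → p ≠ 2 → 0 < (p - 1) * l → ∃ k, 0 < k ∧ (p - 1) * l = 2 * k ∧
      2 * k / (p - 1) = l := fun {p l} hp hp2 hpos => by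
    obtain ⟨c, hc⟩ := hp.even_sub_one hp2
    refine ⟨c * l, ?_, by rw [hc]; ring, ?_⟩
    · rw [hc] at hpos
      exact Nat.pos_of_ne_zero fun h => by rw [← two_mul, mul_assoc, h] at hpos; simp at hpos
    · rw [show 2 * (c * l) = (p - 1) * l by rw [hc]; ring,
        Nat.mul_div_cancel_left _ (Nat.sub_pos_of_lt hp.one_lt)]
  have hTq : 942 ^ ((q - 1) * i) ≤ 2 ^ min ((q - 1) * i) ((q - 1) * u) *
      q ^ min i (finrank ℝ (cyclKer s {2})) * ((q - 1) * i / 2 + 1).factorial ^ 2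
        * 100 ^ ((q - 1) * i) := by
    obtain ⟨k, hk, hk2, hki⟩ := hbound hq hq2 hqpos
    have h1 := pow_le_of_cyclProd_eq_zero hq hr hq2 hr2 hqr hL hmin hs.2 hs.1 (hW ▸ h0) hk
      (hi.trans hk2)
    rwa [hki, ← hk2, hu, show k = (q - 1) * i / 2 by lia] at h1
  have hTr : 942 ^ ((r - 1) * j) ≤ 2 ^ min ((r - 1) * j) ((r - 1) * v) *
      r ^ min j (finrank ℝ (cyclKer s {2})) * ((r - 1) * j / 2 + 1).factorial ^ 2
        * 100 ^ ((r - 1) * j) := by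
    obtain ⟨k, hk, hk2, hki⟩ := hbound hr hr2 hrpos
    have h1 := pow_le_of_cyclProd_eq_zero hr hq hr2 hq2 hqr.symm hL hmin hs.2 hs.1 (hW' ▸ h0) hk
      (hj.trans hk2)
    rwa [hki, ← hk2, hv, show k = (r - 1) * j / 2 by lia] at h1
  rw [show finrank ℝ (cyclKer s {2}) = 24 - (q - 1) * i - (r - 1) * j by lia] at hTq hTr
  have hrange : ∀ {c l : ℕ}, 0 < c → c * l ≤ 24 → l ∈ Finset.range (24 / c + 1) :=
    fun {c l} hc h => Finset.mem_range.mpr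
      (Nat.lt_succ_of_le ((Nat.le_div_iff_mul_le hc).mpr (by rwa [mul_comm])))
  exact hN i (hrange hq1 (by lia)) j (hrange hr1 (by lia)) (Nat.pos_of_mul_pos_left hqpos)
    (Nat.pos_of_mul_pos_left hrpos) (by lia) w (hrange (Nat.mul_pos hq1 hr1) (by lia))
    (Nat.pos_of_mul_pos_left hqrpos) u (hrange hq1 (by lia)) (by lia) (by lia) hTq v
    (hrange hr1 (by lia)) (by lia) (by lia) hTr

end

end CyclotomicKernelNeBot

section CyclotomicKernelInduction

open Module Polynomial

variable {E : Type*} [NormedAddCommGroup E] [InnerProductSpace ℝ E] [FiniteDimensional ℝ E]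
  [MeasurableSpace E] [BorelSpace E]
  {L : Submodule ℤ E} [DiscreteTopology L] [IsZLattice ℝ L]

theorem cyclKer_orderOf_ne_bot
    (hL : ∀ x, x ∈ L ↔ ∀ y ∈ L, ∃ k : ℤ, ⟪x, y⟫ = (k : ℝ))
    (hmin : ∀ x ∈ L, x ≠ 0 → 6 ≤ ⟪x, x⟫) (hE : finrank ℝ E = 48)
    (hodd : ∀ q, q.Prime → q ≠ 2 → ∀ t : End ℝ E, IsLatticeIsometry L t → orderOf t = q →
      finrank ℝ (cyclKer t {1}) ≤ 22)
    (htwo : ∀ t : End ℝ E, IsLatticeIsometry L t → orderOf t = 2 → t ≠ -1 →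
      finrank ℝ (cyclKer t {1}) = 24) :
    ∀ m, 0 < m → ∀ s : End ℝ E, IsLatticeIsometry L s → orderOf s = m → cyclKer s {m} ≠ ⊥ := by
  intro m
  induction m using Nat.strong_induction_on with | _ m ih
  intro hm s hs hsm hbot
  have hs1 : s ^ m = 1 := hsm ▸ pow_orderOf_eq_one s
  have hE0 : Nontrivial E := nontrivial_of_finrank_pos (R := ℝ) (by lia)
  have hm1 : m ≠ 1 := by
    rintro rfl
    rw [pow_one] at hs1
    obtain ⟨x, hx⟩ := exists_ne (0 : E)
    refine hx ((Submodule.mem_bot ℝ).mp (hbot ▸ mem_cyclKer_singleton.mpr ?_))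
    simp [hs1]
  have h0 : aeval s (cyclProd m.divisors) = 0 := by
    rw [cyclProd_divisors hm]
    simp [hs1]
  have hzero : finrank ℝ (cyclKer s {m}) = 0 := by rw [hbot, finrank_bot]
  have htot : finrank ℝ (cyclKer s m.divisors) = 48 := by
    rw [cyclKer, h0, LinearMap.ker_zero, finrank_top, hE]
  have hsub : ∀ n p, p.Prime → m = n * p → ¬ p ∣ n ∧ cyclKer s {n} ≠ ⊥ := by
    intro n p hp hmn
    have hn : 0 < n := Nat.pos_of_mul_pos_right (hmn ▸ hm)
    have h1 := ih n (by have := hp.two_le; nlinarith) hn (s ^ p) (hs.pow p) (by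
      rw [orderOf_pow_of_dvd hp.ne_zero (hsm ▸ hmn ▸ dvd_mul_left p n), hsm, hmn,
        Nat.mul_div_cancel _ hp.pos])
    have h2 : ¬ p ∣ n := fun h => h1 (by rw [cyclKer_pow_of_dvd hp h, ← hmn, hbot])
    refine ⟨h2, fun h => h1 (le_bot_iff.mp (h ▸ ?_))⟩
    exact cyclKer_pow_of_not_dvd hp h2 (hmn ▸ hbot)
  have hpow : ∀ j p, p.Prime → m = j * p → 0 < j ∧ orderOf (s ^ j) = p := by
    intro j p hp hmj
    have hj : 0 < j := Nat.pos_of_mul_pos_right (hmj ▸ hm)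
    exact ⟨hj, by rw [orderOf_pow_of_dvd hj.ne' (hsm ▸ hmj ▸ dvd_mul_right j p), hsm, hmj,
        Nat.mul_div_cancel_left _ hj]⟩
  have h22 : ∀ j p, p.Prime → p ≠ 2 → m = j * p → finrank ℝ (cyclKer s j.divisors) ≤ 22 := by
    intro j p hp hp2 hmj
    obtain ⟨hj, hord⟩ := hpow j p hp hmj
    rw [← cyclKer_pow_one hj]
    exact hodd p hp hp2 _ (hs.pow j) hord
  have h24' : ∀ j, m = j * 2 → cyclKer s j.divisors ≠ ⊥ →
      finrank ℝ (cyclKer s j.divisors) = 24 := by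
    intro j hmj hne
    obtain ⟨hj, hord⟩ := hpow j 2 Nat.prime_two hmj
    rw [← cyclKer_pow_one hj] at hne ⊢
    refine htwo _ (hs.pow j) hord fun h => hne ?_
    rw [h, cyclKer, cyclProd_singleton, cyclotomic_one, LinearMap.ker_eq_bot']
    intro x hx
    have h1 : -x - x = 0 := by simpa using hx
    rwa [← neg_add', neg_eq_zero, ← two_smul ℝ, smul_eq_zero_iff_right two_ne_zero] at h1
  have h24 : ∀ j p, p.Prime → m = j * p → finrank ℝ (cyclKer s j.divisors) ≤ 24 := by
    intro j p hp hmj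
    rcases eq_or_ne p 2 with rfl | hp2
    · by_cases hne : cyclKer s j.divisors = ⊥
      · rw [hne, finrank_bot]
        lia
      · exact (h24' j hmj hne).le
    · exact (h22 j p hp hp2 hmj).trans (by lia)
  have htot' : ∀ n p, p.Prime → m = n * p → n.totient ≤ finrank ℝ (cyclKer s n.divisors) := by
    intro n p hp hmn
    have hn := (hpow n p hp hmn).1
    refine le_trans (Nat.le_of_dvd (Submodule.one_le_finrank_iff.mpr (hsub n p hp hmn).2)
      (totient_dvd_finrank_cyclKer hs.2 h0 hn (Nat.mem_divisors.mpr ⟨⟨p, hmn⟩, hm.ne'⟩)))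
      (Submodule.finrank_mono (cyclKer_mono ?_))
    simpa using hn.ne'
  have hprime : ¬ m.Prime := by
    intro hp
    have h1 := h24 1 m hp (one_mul m).symm
    rw [finrank_cyclKer, hp.divisors, Finset.sum_pair hp.one_lt.ne, hzero] at htot
    rw [Nat.divisors_one] at h1
    lia
  have hpq : ∀ p q, p.Prime → q.Prime → p ≠ q → m ≠ p * q := by
    rintro p q hp hq hne rfl
    have h1 := h24 p q hq rfl
    have h2 := h24 q p hp (mul_comm p q)
    have h3 : finrank ℝ (cyclKer s p.divisors) ≤ 22 ∨ finrank ℝ (cyclKer s q.divisors) ≤ 22 := by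
      by_cases hp2 : p = 2
      · exact .inl (h22 p q hq (fun h => hne (hp2.trans h.symm)) rfl)
      · exact .inr (h22 q p hp hp2 (mul_comm p q))
    rw [finrank_cyclKer, sum_divisors_mul_primes hp hq hne, hzero] at htot
    have h4 : ∀ {l : ℕ}, l.Prime → finrank ℝ (cyclKer s l.divisors)
        = finrank ℝ (cyclKer s {1}) + finrank ℝ (cyclKer s {l}) := fun hl => by
      rw [finrank_cyclKer, hl.divisors, Finset.sum_pair hl.one_lt.ne]
    rw [h4 hp] at h1 h3
    rw [h4 hq] at h2 h3
    lia
  have hsq : Squarefree m := by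
    rw [Nat.squarefree_iff_prime_squarefree]
    rintro p hp ⟨c, hc⟩
    exact (hsub (p * c) p hp (by rw [hc]; ring)).1 (dvd_mul_right p c)
  have hdiv : ∀ {p}, p ∣ m → m = m / p * p := fun h => (Nat.div_mul_cancel h).symm
  obtain ⟨q, r, hq, hr, hq2, hr2, hqr, hN, rfl⟩ := exists_two_mul_primes_of_totient_le hsq hm1
    hprime hpq (fun p hp h => (htot' _ p hp (hdiv h)).trans (h24 _ p hp (hdiv h)))
    (fun p hp hp2 h => (htot' _ p hp (hdiv h)).trans (h22 _ p hp hp2 (hdiv h)))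
  have hqr0 := (hsub (q * r) 2 Nat.prime_two (by ring)).2
  refine false_of_noDimensionVector hL hmin hs hE hq hr hq2 hr2 hqr hN
    (aeval_cyclProd_properDivisors hm hs1 hbot) (h24' _ (by ring) fun h => hqr0 (le_bot_iff.mp ?_))
    (h22 _ r hr hr2 rfl) (h22 _ q hq hq2 (by ring)) (hsub _ r hr rfl).2
    (hsub _ q hq (by ring)).2 hqr0
  rw [← h]
  exact cyclKer_mono (by simp [hq.ne_zero, hr.ne_zero])

end CyclotomicKernelInduction

section CyclotomicDvdMinpoly

open Module Polynomial

variable {E : Type*} [NormedAddCommGroup E] [InnerProductSpace ℝ E] [FiniteDimensional ℝ E]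
  {L : Submodule ℤ E} {s : End ℝ E}

omit [FiniteDimensional ℝ E] in
lemma coe_aeval_cyclRes_real (S : Finset ℕ) (p : ℝ[X]) (x : cyclKer s S) :
    (aeval (cyclRes s S) p x : E) = aeval s p x := by
  induction p using Polynomial.induction_on generalizing x with
  | C a => simp
  | add p q hp hq => simp [hp, hq]
  | monomial n a ih =>
    rw [pow_succ, ← mul_assoc, map_mul _ _ X, map_mul _ _ X, aeval_X, aeval_X,
      Module.End.mul_apply, Module.End.mul_apply, ih]
    rfl

lemma cyclotomic_dvd_minpoly [DiscreteTopology L] [IsZLattice ℝ L] (hs : ∀ x ∈ L, s x ∈ L)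
    {W : Finset ℕ} (h0 : aeval s (cyclProd W) = 0) {d : ℕ} (hd0 : 0 < d) (hd : d ∈ W)
    (hne : cyclKer s {d} ≠ ⊥) : cyclotomic d ℝ ∣ minpoly ℝ s := by
  obtain ⟨β, M, hM, hM0⟩ := exists_int_toMatrix_cyclRes_singleton hs h0 hd
  obtain ⟨k, hk, hcard⟩ := exists_charpoly_eq_cyclotomic_pow hd0 hM0
  have hk0 : k ≠ 0 := by
    rintro rfl
    rw [mul_zero, Fintype.card_fin] at hcard
    exact hne (Submodule.finrank_eq_zero.mp hcard)
  have hn : Fintype.card (Fin (finrank ℝ (cyclKer s {d}))) ≠ 0 := by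
    rwa [Fintype.card_fin, Ne, Submodule.finrank_eq_zero]
  have h1 : aeval (LinearMap.toMatrixAlgEquiv β (cyclRes s {d})) (minpoly ℝ s) = 0 := by
    rw [aeval_algHom_apply, EmbeddingLike.map_eq_zero_iff]
    ext x
    rw [coe_aeval_cyclRes_real, minpoly.aeval]
    rfl
  have h2 := charpoly_dvd_pow_of_aeval_eq_zero _ _ h1
  have h3 : LinearMap.toMatrixAlgEquiv β (cyclRes s {d}) = M.map (Int.castRingHom ℝ) := hM
  rw [h3, Matrix.charpoly_map, hk, Polynomial.map_pow, map_cyclotomic] at h2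
  have : NeZero (d : ℝ) := ⟨by exact_mod_cast hd0.ne'⟩
  exact ((squarefree_cyclotomic d ℝ).dvd_pow_iff_dvd hn).mp
    ((dvd_pow_self _ hk0).trans h2)

omit [FiniteDimensional ℝ E] in
lemma discreteTopology_of_le_inner_self {c : ℝ} (hc : 0 < c)
    (hmin : ∀ x ∈ L, x ≠ 0 → c ≤ ⟪x, x⟫) : DiscreteTopology L := by
  rw [discreteTopology_iff_isOpen_singleton_zero, Metric.isOpen_singleton_iff]
  refine ⟨√c, Real.sqrt_pos.mpr hc, fun x hx => ?_⟩
  by_contra h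
  rw [dist_zero_right, Real.lt_sqrt (norm_nonneg _)] at hx
  have := hmin x x.2 (by simpa using h)
  rw [real_inner_self_eq_norm_sq] at this
  exact absurd hx (not_lt.mpr this)

omit [FiniteDimensional ℝ E] in
lemma span_cyclKer_one (hL : Submodule.span ℝ (L : Set E) = ⊤)
    (hs : ∀ x ∈ L, s x ∈ L) {q : ℕ} (hq : 0 < q) (hsq : s ^ q = 1) :
    Submodule.span ℝ {x | x ∈ L ∧ x ∈ cyclKer s {1}} = cyclKer s {1} := by
  refine le_antisymm (Submodule.span_le.mpr fun x hx => hx.2) ?_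
  refine cyclKer_le_span (T := q.divisors \ {1}) Finset.disjoint_sdiff ?_ hL hs
  rw [Finset.union_sdiff_of_subset (by simpa using hq.ne'), cyclProd_divisors hq]
  simp [hsq]

end CyclotomicDvdMinpoly

section Automorphism

lemma exists_linearEquiv_of_orderOf_pos {E : Type*} [AddCommGroup E] [Module ℝ E]
    {t : Module.End ℝ E} (ht : 0 < orderOf t) : ∃ τ : E ≃ₗ[ℝ] E, τ.toLinearMap = t := by
  obtain ⟨u, hu⟩ := (orderOf_pos_iff.mp ht).isUnit
  exact ⟨LinearMap.GeneralLinearGroup.generalLinearEquiv ℝ E u, hu⟩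

lemma orderOf_toLinearMap {E : Type*} [AddCommGroup E] [Module ℝ E] (τ : E ≃ₗ[ℝ] E) :
    orderOf (τ.toLinearMap : Module.End ℝ E) = orderOf τ :=
  orderOf_injective (LinearEquiv.automorphismGroup.toLinearMapMonoidHom (R := ℝ) (M := E))
    LinearEquiv.toLinearMap_injective τ

lemma isAutoOf_of_isLatticeIsometry {n : ℕ} {L : Submodule ℤ (Eu n)} {τ : Eu n ≃ₗ[ℝ] Eu n}
    (hτ : 0 < orderOf τ) (h : IsLatticeIsometry L τ.toLinearMap) : IsAutoOf τ L := by
  refine ⟨h.1, Set.Subset.antisymm (Set.image_subset_iff.mpr h.2) fun x hx => ?_⟩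
  have h1 := (h.pow (orderOf τ - 1)).2 x hx
  refine ⟨_, h1, ?_⟩
  have h2 : (τ.toLinearMap : Module.End ℝ (Eu n)) ^ orderOf τ = 1 :=
    orderOf_toLinearMap τ ▸ pow_orderOf_eq_one _
  rw [← Nat.sub_add_cancel hτ, pow_succ'] at h2
  exact LinearMap.congr_fun h2 x

end Automorphism

/-- Suppose `L` is extremal even unimodular of dimension 48, every
automorphism of odd prime order has fixed lattice of dimension ≤ 22, and every
automorphism of order 2 other than `-1` has fixed lattice of dimension exactly 24.
Then for every `σ ∈ Aut(L)` of order `m`, the cyclotomic polynomial `Φ_m`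
divides the minimal polynomial of `σ`. -/
theorem stmt13 (L : Submodule ℤ (Eu 48)) (hL : IsExtremal48 L)
    (hodd : ∀ (q : ℕ), q.Prime → Odd q → ∀ τ : Eu 48 ≃ₗ[ℝ] Eu 48,
      IsAutoOf τ L → orderOf τ = q →
      Module.finrank ℝ (Submodule.span ℝ ((latIn L (fixSpace τ)) : Set (Eu 48))) ≤ 22)
    (htwo : ∀ τ : Eu 48 ≃ₗ[ℝ] Eu 48, IsAutoOf τ L → orderOf τ = 2 →
      τ ≠ LinearEquiv.neg ℝ →
      Module.finrank ℝ (Submodule.span ℝ ((latIn L (fixSpace τ)) : Set (Eu 48))) = 24) :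
    ∀ (m : ℕ) (σ : Eu 48 ≃ₗ[ℝ] Eu 48), IsAutoOf σ L → orderOf σ = m →
      Polynomial.cyclotomic m ℝ ∣ minpoly ℝ (σ.toLinearMap : Module.End ℝ (Eu 48)) := by
  obtain ⟨hspan, -, hdual, hmin, -⟩ := hL
  have hdisc : DiscreteTopology L := discreteTopology_of_le_inner_self (by norm_num) hmin
  have hlat : IsZLattice ℝ L := ⟨hspan⟩
  have hL : ∀ x, x ∈ L ↔ ∀ y ∈ L, ∃ k : ℤ, ⟪x, y⟫ = (k : ℝ) := fun x => by
    rw [← SetLike.mem_coe, ← hdual]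
    rfl
  have hprime : ∀ q, q.Prime → ∀ t : Module.End ℝ (Eu 48), IsLatticeIsometry L t →
      orderOf t = q → ∃ τ : Eu 48 ≃ₗ[ℝ] Eu 48, IsAutoOf τ L ∧ orderOf τ = q ∧ τ.toLinearMap = t ∧
        Submodule.span ℝ (latIn L (fixSpace τ) : Set (Eu 48)) = cyclKer t {1} := by
    intro q hq t ht htq
    obtain ⟨τ, hτ⟩ := exists_linearEquiv_of_orderOf_pos (htq ▸ hq.pos)
    have hτq : orderOf τ = q := by rw [← orderOf_toLinearMap, hτ, htq]
    refine ⟨τ, isAutoOf_of_isLatticeIsometry (hτq ▸ hq.pos) (hτ ▸ ht), hτq, hτ, ?_⟩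
    rw [← span_cyclKer_one hspan ht.2 hq.pos (htq ▸ pow_orderOf_eq_one t)]
    congr 1
    ext x
    rw [Set.mem_ofPred_eq, mem_cyclKer_singleton]
    simp [latIn, fixSpace, hτ, Polynomial.cyclotomic_one]
  intro m σ hσ hm
  rcases Nat.eq_zero_or_pos m with rfl | hm0
  · simp
  have hs : IsLatticeIsometry L σ.toLinearMap :=
    ⟨hσ.1, fun x hx => by
      have h1 : σ x ∈ σ '' (L : Set (Eu 48)) := ⟨x, hx, rfl⟩
      rwa [hσ.2] at h1⟩
  have hord : orderOf (σ.toLinearMap : Module.End ℝ (Eu 48)) = m := by rw [orderOf_toLinearMap, hm]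
  refine cyclotomic_dvd_minpoly hs.2 (W := m.divisors) ?_ hm0 (Nat.mem_divisors_self m hm0.ne')
    (cyclKer_orderOf_ne_bot hL hmin (by simp) ?_ ?_ m hm0 _ hs hord)
  · have h1 : (σ.toLinearMap : Module.End ℝ (Eu 48)) ^ m = 1 := hord ▸ pow_orderOf_eq_one _
    rw [cyclProd_divisors hm0]
    simp [h1]
  · intro q hq hq2 t ht htq
    obtain ⟨τ, hτ, hτq, -, hfix⟩ := hprime q hq t ht htq
    exact hfix ▸ hodd q hq (hq.odd_of_ne_two hq2) τ hτ hτq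
  · intro t ht ht2 hne
    obtain ⟨τ, hτ, hτ2, hτt, hfix⟩ := hprime 2 Nat.prime_two t ht ht2
    refine hfix ▸ htwo τ hτ hτ2 fun h => hne ?_
    rw [← hτt, h]
    rfl
end
end

section
/- Let L be an integral lattice and v ∈ L \ 2L^# with (v,v) ≡ 0 (mod 4). Then the 2-neighbor L^{(v),2} = ⟨{ℓ ∈ L : (v,ℓ) even} ∪ {v/2}⟩_ℤ is an integral lattice with the same determinant as L. -/
open scoped RealInnerProductSpace

noncomputable section

open Module ZLattice MeasureTheory in
theorem det_gram_eq_of_covolume_eq {ι E : Type*} [Fintype ι] [DecidableEq ι]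
    [NormedAddCommGroup E] [InnerProductSpace ℝ E] [FiniteDimensional ℝ E]
    [MeasurableSpace E] [BorelSpace E] (b₀ : OrthonormalBasis ι ℝ E)
    {L M : Submodule ℤ E} [DiscreteTopology L] [IsZLattice ℝ L] [DiscreteTopology M]
    [IsZLattice ℝ M] (b : Basis ι ℤ L) (c : Basis ι ℤ M) (h : covolume L = covolume M) :
    (Matrix.gram ℝ fun i => (b i : E)).det = (Matrix.gram ℝ fun i => (c i : E)).det := by
  have gram_det (w : ι → E) : (Matrix.gram ℝ w).det = |b₀.toBasis.det w| ^ 2 := by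
    rw [Matrix.gram_eq_conjTranspose_mul b₀, Matrix.det_mul, Matrix.det_conjTranspose, sq_abs,
      Basis.det_apply, star_trivial, sq]
    rfl
  have hpos := covolume_pos L volume
  rw [covolume_eq_det_mul_measureReal L volume b b₀.toBasis] at h hpos
  rw [covolume_eq_det_mul_measureReal M volume c b₀.toBasis] at h
  rw [gram_det, gram_det]
  exact congrArg (· ^ 2) (mul_right_cancel₀ (right_ne_zero_of_mul hpos.ne') h)

theorem isZLattice_of_two_smul_mem {E : Type*} [NormedAddCommGroup E] [NormedSpace ℝ E]
    {L M : Submodule ℤ E} [DiscreteTopology L] [DiscreteTopology M] [IsZLattice ℝ L]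
    (h : ∀ x ∈ L, (2 : ℝ) • x ∈ M) : IsZLattice ℝ M where
  span_top := by
    rw [eq_top_iff, ← IsZLattice.span_top (K := ℝ) (L := L), Submodule.span_le]
    intro x hx
    have := Submodule.smul_mem _ (2 : ℝ)⁻¹ (Submodule.subset_span (R := ℝ) (h x hx))
    rwa [inv_smul_smul₀ two_ne_zero] at this

theorem discreteTopology_of_two_smul_mem {E : Type*} [NormedAddCommGroup E] [NormedSpace ℝ E]
    {L M : Submodule ℤ E} [DiscreteTopology L] (h : ∀ x ∈ M, (2 : ℝ) • x ∈ L) :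
    DiscreteTopology M := by
  let e : E ≃L[ℝ] E := ContinuousLinearEquiv.smulLeft (Units.mk0 (2 : ℝ) two_ne_zero)
  exact DiscreteTopology.of_subset
    (inferInstanceAs (DiscreteTopology (ZLattice.comap ℝ L e.toLinearMap))) fun x hx => h x hx

/-- The sublattice of vectors of `L` whose pairing with `v` is even. -/
def evenPairing {E : Type*} [NormedAddCommGroup E] [InnerProductSpace ℝ E]
    (L : Submodule ℤ E) (v : E) : Submodule ℤ E where
  carrier := {ℓ | ℓ ∈ L ∧ ∃ k : ℤ, ⟪v, ℓ⟫ = 2 * (k : ℝ)}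
  zero_mem' := ⟨L.zero_mem, 0, by simp⟩
  add_mem' := by
    rintro a b ⟨ha, k, hk⟩ ⟨hb, l, hl⟩
    exact ⟨L.add_mem ha hb, k + l, by rw [inner_add_right, hk, hl]; push_cast; ring⟩
  smul_mem' := by
    rintro m a ⟨ha, k, hk⟩
    refine ⟨L.smul_mem m ha, m * k, ?_⟩
    rw [← Int.cast_smul_eq_zsmul ℝ, real_inner_smul_right, hk]
    push_cast
    ring

/-- The 2-neighbor of `L` at `v`. -/
def twoNeighbor {E : Type*} [NormedAddCommGroup E] [InnerProductSpace ℝ E]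
    (L : Submodule ℤ E) (v : E) : Submodule ℤ E :=
  evenPairing L v ⊔ Submodule.span ℤ {(2 : ℝ)⁻¹ • v}

section

variable {E : Type*} [NormedAddCommGroup E] [InnerProductSpace ℝ E] {L : Submodule ℤ E} {v : E}

theorem span_evenPairing_union (L : Submodule ℤ E) (v : E) :
    Submodule.span ℤ ({ℓ | ℓ ∈ L ∧ ∃ k : ℤ, ⟪v, ℓ⟫ = 2 * (k : ℝ)} ∪ {(2 : ℝ)⁻¹ • v}) =
      twoNeighbor L v := by
  rw [Submodule.span_union]
  exact congrArg (· ⊔ _) (Submodule.span_eq (evenPairing L v))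

theorem mem_twoNeighbor {x : E} :
    x ∈ twoNeighbor L v ↔ ∃ l ∈ evenPairing L v, ∃ m : ℤ, x = l + (m : ℝ) • (2 : ℝ)⁻¹ • v := by
  simp only [twoNeighbor, Submodule.mem_sup, Submodule.mem_span_singleton,
    Int.cast_smul_eq_zsmul, exists_exists_eq_and, eq_comm (a := x)]

theorem inner_twoNeighbor_integral (hint : ∀ x ∈ L, ∀ y ∈ L, ∃ k : ℤ, ⟪x, y⟫ = (k : ℝ))
    (hv4 : ∃ k : ℤ, ⟪v, v⟫ = 4 * (k : ℝ)) :
    ∀ x ∈ twoNeighbor L v, ∀ y ∈ twoNeighbor L v, ∃ k : ℤ, ⟪x, y⟫ = (k : ℝ) := by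
  intro x hx y hy
  obtain ⟨a, ⟨ha, p, hp⟩, m, rfl⟩ := mem_twoNeighbor.1 hx
  obtain ⟨b, ⟨hb, q, hq⟩, l, rfl⟩ := mem_twoNeighbor.1 hy
  obtain ⟨r, hr⟩ := hint a ha b hb
  obtain ⟨s, hs⟩ := hv4
  refine ⟨r + l * p + m * q + m * l * s, ?_⟩
  simp only [inner_add_left, inner_add_right, real_inner_smul_left, real_inner_smul_right,
    real_inner_comm v a, hp, hq, hr, hs]
  push_cast
  ring

theorem relIndex_evenPairing (hint : ∀ x ∈ L, ∀ y ∈ L, ∃ k : ℤ, ⟪x, y⟫ = (k : ℝ)) (hv : v ∈ L)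
    (hodd : ∃ a ∈ L, a ∉ evenPairing L v) :
    (evenPairing L v).toAddSubgroup.relIndex L.toAddSubgroup = 2 := by
  rw [AddSubgroup.relIndex_eq_two_iff_exists_notMem_and]
  obtain ⟨a, ha, ha'⟩ := hodd
  refine ⟨a, ha, ha', fun b hb => ?_⟩
  obtain ⟨k, hk⟩ := hint v hv a ha
  obtain ⟨l, hl⟩ := hint v hv b hb
  rcases Int.even_or_odd' k with ⟨p, rfl | rfl⟩
  · exact absurd ⟨ha, p, by rw [hk]; push_cast; ring⟩ ha'
  rcases Int.even_or_odd' l with ⟨q, rfl | rfl⟩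
  · exact .inr ⟨hb, q, by rw [hl]; push_cast; ring⟩
  · exact .inl ⟨L.add_mem hb ha, p + q + 1, by
      rw [inner_add_right, hk, hl]; push_cast; ring⟩

theorem relIndex_evenPairing_twoNeighbor (hv : v ∈ evenPairing L v)
    (hhalf : (2 : ℝ)⁻¹ • v ∉ L) :
    (evenPairing L v).toAddSubgroup.relIndex (twoNeighbor L v).toAddSubgroup = 2 := by
  rw [AddSubgroup.relIndex_eq_two_iff_exists_notMem_and]
  refine ⟨(2 : ℝ)⁻¹ • v, mem_twoNeighbor.2 ⟨0, zero_mem _, 1, by simp⟩,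
    fun h => hhalf h.1, fun b hb => ?_⟩
  obtain ⟨l, hl, m, rfl⟩ := mem_twoNeighbor.1 hb
  rcases Int.even_or_odd' m with ⟨p, rfl | rfl⟩
  · right
    have : l + ((2 * p : ℤ) : ℝ) • (2 : ℝ)⁻¹ • v = l + p • v := by
      rw [← Int.cast_smul_eq_zsmul ℝ]; push_cast; module
    rw [this]
    exact add_mem hl ((evenPairing L v).smul_mem p hv)
  · left
    have : l + ((2 * p + 1 : ℤ) : ℝ) • (2 : ℝ)⁻¹ • v + (2 : ℝ)⁻¹ • v = l + (p + 1) • v := by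
      rw [← Int.cast_smul_eq_zsmul ℝ]; push_cast; module
    rw [this]
    exact add_mem hl ((evenPairing L v).smul_mem (p + 1) hv)

end

/-- For an integral lattice `L` and `v ∈ L \ 2L^#` with `4 ∣ (v,v)`,
the 2-neighbor `L^{(v),2} = ⟨{ℓ ∈ L : (v,ℓ) even} ∪ {v/2}⟩_ℤ` is an integral
lattice with the same determinant as `L`. -/
theorem stmt14 {n : ℕ} (L : Submodule ℤ (Eu n))
    (hint : ∀ x ∈ L, ∀ y ∈ L, ∃ k : ℤ, ⟪x, y⟫ = (k : ℝ))
    (bL : Fin n → Eu n) (hbL : LinearIndependent ℝ bL)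
    (hspan : Submodule.span ℤ (Set.range bL) = L)
    (v : Eu n) (hv : v ∈ L)
    (hv2 : ¬ ∃ w ∈ dualSet (L : Set (Eu n)), v = (2 : ℝ) • w)
    (hv4 : ∃ k : ℤ, ⟪v, v⟫ = 4 * (k : ℝ)) :
    (∀ x ∈ Submodule.span ℤ
        ({ℓ | ℓ ∈ L ∧ ∃ k : ℤ, ⟪v, ℓ⟫ = 2 * (k : ℝ)} ∪ {(2 : ℝ)⁻¹ • v}),
      ∀ y ∈ Submodule.span ℤ
        ({ℓ | ℓ ∈ L ∧ ∃ k : ℤ, ⟪v, ℓ⟫ = 2 * (k : ℝ)} ∪ {(2 : ℝ)⁻¹ • v}),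
        ∃ k : ℤ, ⟪x, y⟫ = (k : ℝ)) ∧
    ∃ bN : Fin n → Eu n, LinearIndependent ℝ bN ∧
      Submodule.span ℤ (Set.range bN) = Submodule.span ℤ
        ({ℓ | ℓ ∈ L ∧ ∃ k : ℤ, ⟪v, ℓ⟫ = 2 * (k : ℝ)} ∪ {(2 : ℝ)⁻¹ • v}) ∧
      Matrix.det (Matrix.of fun i j => ⟪bN i, bN j⟫) =
        Matrix.det (Matrix.of fun i j => ⟪bL i, bL j⟫) := by
  rw [span_evenPairing_union]
  refine ⟨inner_twoNeighbor_integral hint hv4, ?_⟩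
  have hv' : v ∈ evenPairing L v := by
    obtain ⟨k, hk⟩ := hv4
    exact ⟨hv, 2 * k, by rw [hk]; push_cast; ring⟩
  have hhalf : (2 : ℝ)⁻¹ • v ∉ L := fun h =>
    hv2 ⟨_, fun y hy => hint _ h y hy, (smul_inv_smul₀ two_ne_zero v).symm⟩
  have hodd : ∃ a ∈ L, a ∉ evenPairing L v := by
    by_contra! h
    refine hv2 ⟨(2 : ℝ)⁻¹ • v, fun y hy => ?_, (smul_inv_smul₀ two_ne_zero v).symm⟩
    obtain ⟨-, k, hk⟩ := h y hy
    exact ⟨k, by rw [real_inner_smul_left, hk]; ring⟩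
  let B : Module.Basis (Fin n) ℝ (Eu n) :=
    basisOfLinearIndependentOfCardEqFinrank' bL hbL (by simp)
  have hB : ⇑B = bL := coe_basisOfLinearIndependentOfCardEqFinrank' ..
  have hBL : Submodule.span ℤ (Set.range B) = L := by rw [hB, hspan]
  have : DiscreteTopology L := hBL ▸ inferInstance
  have : IsZLattice ℝ L := ⟨by rw [← hBL]; exact ZSpan.span_top B⟩
  have htwo : ∀ x ∈ L, (2 : ℝ) • x ∈ evenPairing L v := by
    intro x hx
    obtain ⟨k, hk⟩ := hint v hv x hx
    refine ⟨?_, k, by rw [real_inner_smul_right, hk]⟩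
    rw [two_smul]
    exact L.add_mem hx hx
  have hle : evenPairing L v ≤ twoNeighbor L v := le_sup_left
  have : DiscreteTopology (twoNeighbor L v) := by
    refine discreteTopology_of_two_smul_mem (L := L) fun x hx => ?_
    obtain ⟨l, hl, m, rfl⟩ := mem_twoNeighbor.1 hx
    have : (2 : ℝ) • (l + (m : ℝ) • (2 : ℝ)⁻¹ • v) = (2 : ℤ) • l + m • v := by
      simp only [← Int.cast_smul_eq_zsmul ℝ]; push_cast; module
    rw [this]
    exact L.add_mem (L.smul_mem 2 hl.1) (L.smul_mem m hv)
  have : DiscreteTopology (evenPairing L v) := DiscreteTopology.of_subset ‹_› hle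
  have : IsZLattice ℝ (evenPairing L v) := isZLattice_of_two_smul_mem htwo
  have : IsZLattice ℝ (twoNeighbor L v) :=
    isZLattice_of_two_smul_mem fun x hx => hle (htwo x hx)
  have hcov : ZLattice.covolume (twoNeighbor L v) = ZLattice.covolume L := by
    have h₁ := ZLattice.covolume_div_covolume_eq_relIndex' (evenPairing L v) L fun _ h => h.1
    have h₂ := ZLattice.covolume_div_covolume_eq_relIndex' _ _ hle
    rw [relIndex_evenPairing hint hv hodd, div_eq_iff (ZLattice.covolume_ne_zero L MeasureTheory.volume)] at h₁
    rw [relIndex_evenPairing_twoNeighbor hv' hhalf, div_eq_iff (ZLattice.covolume_ne_zero _ MeasureTheory.volume),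
      h₁] at h₂
    exact (mul_left_cancel₀ (by norm_num) h₂).symm
  let c : Module.Basis (Fin n) ℤ (twoNeighbor L v) :=
    Module.finBasisOfFinrankEq ℤ _ (by rw [ZLattice.rank ℝ]; simp)
  let b : Module.Basis (Fin n) ℤ L :=
    (B.restrictScalars ℤ).map (LinearEquiv.ofEq _ _ hBL)
  have hb (i : Fin n) : (b i : Eu n) = bL i := by simp [b, hB]
  have hc : (fun i => (c i : Eu n)) = c.ofZLatticeBasis ℝ (twoNeighbor L v) := by
    ext1 i
    simp
  refine ⟨fun i => c i, ?_, ?_, ?_⟩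
  · rw [hc]
    exact (c.ofZLatticeBasis ℝ (twoNeighbor L v)).linearIndependent
  · rw [hc]
    exact c.ofZLatticeBasis_span ℝ
  · have h := det_gram_eq_of_covolume_eq (EuclideanSpace.basisFun (Fin n) ℝ) c b hcov
    simp only [hb] at h
    exact h
end
end
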